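/- arXiv:math/0208166 — 7 statements merged into one kernel-verified Lean document; each statement's English description precedes it below -/
import Mathlib

section
/- Let k ≥ 3 with 2k ≤ n + 1, and let H_1 and H_2 be any two k-dimensional linear subspaces of V with H_1 ∩ H_2 = 0. Then the intersection Q_{n+1−k}(H_1) ∩ Q_{n+1−k}(H_2) inside ⋀^{n+1−k} V has dimension equal to max{ C(n+1, k) − 2·(k(n+1−k) + 1), 0 }. -/
open ExteriorAlgebra

/-- `Q K d H` : the `K`-linear span in `⋀^d V` of all elements `x ∧ y ∧ m` with
`x, y ∈ H` and `m ∈ ⋀^(d-2) V`. -/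
def Q (K : Type*) {V : Type*} [Field K] [AddCommGroup V] [Module K V]
    (d : ℕ) (H : Submodule K V) : Submodule K (ExteriorAlgebra K V) :=
  Submodule.span K
    {z | ∃ x ∈ H, ∃ y ∈ H, ∃ m ∈ ⋀[K]^(d-2) V, z = ι K x * ι K y * m}

lemma card_bad {I : Type*} [Fintype I] [DecidableEq I] (A : Finset I) (d : ℕ)
    (hd : A.card + d = Fintype.card I) (hd1 : 1 ≤ d) :
    ((Finset.powersetCard d (Finset.univ : Finset I)).filter
      (fun S => (S ∩ A).card ≤ 1)).card = A.card * d + 1 := by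
  have hAc : Aᶜ.card = d := by rw [Finset.card_compl]; omega
  have key : (Finset.powersetCard d (Finset.univ : Finset I)).filter
      (fun S => (S ∩ A).card ≤ 1) =
      insert Aᶜ ((A ×ˢ Aᶜ).image (fun p => insert p.1 (Aᶜ.erase p.2))) := by
    ext S
    simp only [Finset.mem_filter, Finset.mem_powersetCard, Finset.subset_univ, true_and,
      Finset.mem_insert, Finset.mem_image, Finset.mem_product, Prod.exists]
    constructor
    · rintro ⟨hS, h1⟩
      have hsplit : (S ∩ A).card + (S \ A).card = S.card := by
        rw [add_comm, Finset.card_sdiff_add_card_inter]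
      have hsub : S \ A ⊆ Aᶜ := by
        intro x hx; simp at hx ⊢; exact hx.2
      rcases Nat.lt_or_ge (S ∩ A).card 1 with h0 | h0
      · left
        have : S \ A = Aᶜ := Finset.eq_of_subset_of_card_le hsub (by omega)
        have h0' : S ∩ A = ∅ := Finset.card_eq_zero.1 (by omega)
        rw [← this]
        exact (Finset.sdiff_eq_self_iff_disjoint.2 (Finset.disjoint_iff_inter_eq_empty.2 h0')).symm
      · right
        obtain ⟨a, ha⟩ := Finset.card_eq_one.1 (le_antisymm h1 h0)
        have hc : (Aᶜ \ (S \ A)).card = 1 := by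
          rw [Finset.card_sdiff_of_subset hsub]; omega
        obtain ⟨j, hj⟩ := Finset.card_eq_one.1 hc
        refine ⟨a, j, ⟨?_, ?_⟩, ?_⟩
        · have : a ∈ S ∩ A := by simp [ha]
          exact (Finset.mem_inter.1 this).2
        · have : j ∈ Aᶜ \ (S \ A) := by simp [hj]
          exact (Finset.mem_sdiff.1 this).1
        · ext x
          have e1 := Finset.ext_iff.1 ha x
          have e2 := Finset.ext_iff.1 hj x
          simp at e1 e2 ⊢
          grind
    · rintro (rfl | ⟨a, j, ⟨ha, hj⟩, rfl⟩)
      · refine ⟨hAc, ?_⟩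
        have : Aᶜ ∩ A = ∅ := by ext x; simp
        simp [this]
      · refine ⟨?_, ?_⟩
        · rw [Finset.card_insert_of_notMem, Finset.card_erase_of_mem hj]
          · omega
          · simp [ha]
        · rw [Finset.card_le_one]
          simp
          grind
  rw [key, Finset.card_insert_of_notMem, Finset.card_image_of_injOn, Finset.card_product, hAc]
  · rintro ⟨a, j⟩ h ⟨a', j'⟩ h' e
    simp at h h'
    simp only at e
    have e1 := Finset.ext_iff.1 e a
    have e2 := Finset.ext_iff.1 e j
    have e3 := Finset.ext_iff.1 e a'
    have e4 := Finset.ext_iff.1 e j'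
    simp at e1 e2 e3 e4
    ext <;> grind
  · simp only [Finset.mem_image, Finset.mem_product, Prod.exists, not_exists, not_and]
    rintro a j ⟨ha, hj⟩ e
    have e1 := Finset.ext_iff.1 e a
    simp [ha] at e1

lemma card_good {I : Type*} [Fintype I] [DecidableEq I] (A B : Finset I) (k d : ℕ)
    (hA : A.card = k) (hB : B.card = k) (hAB : Disjoint A B) (hk : 3 ≤ k)
    (hd : k + d = Fintype.card I) (hkd : k ≤ d) :
    ((Finset.powersetCard d (Finset.univ : Finset I)).filter
      (fun S => 2 ≤ (S ∩ A).card ∧ 2 ≤ (S ∩ B).card)).card + 2 * (k * d + 1)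
      = (Fintype.card I).choose k := by
  have h1 := card_bad A d (by omega) (by omega)
  have h2 := card_bad B d (by omega) (by omega)
  rw [hA] at h1
  rw [hB] at h2
  have hdis : Disjoint ((Finset.powersetCard d (Finset.univ : Finset I)).filter
      (fun S => (S ∩ A).card ≤ 1)) ((Finset.powersetCard d (Finset.univ : Finset I)).filter
      (fun S => (S ∩ B).card ≤ 1)) := by
    rw [Finset.disjoint_left]
    intro S hS hS'
    simp at hS hS'
    have hu : S ⊆ (S ∩ A) ∪ (S ∩ B) ∪ (A ∪ B)ᶜ := by
      intro x hx; simp; grind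
    have := Finset.card_le_card hu
    have a1 := Finset.card_union_le ((S ∩ A) ∪ (S ∩ B)) (A ∪ B)ᶜ
    have a2 := Finset.card_union_le (S ∩ A) (S ∩ B)
    rw [Finset.card_compl, Finset.card_union_of_disjoint hAB] at a1
    omega
  have h3 := Finset.card_filter_add_card_filter_not (s := Finset.powersetCard d (Finset.univ : Finset I))
    (fun S => 2 ≤ (S ∩ A).card ∧ 2 ≤ (S ∩ B).card)
  have h4 : (Finset.powersetCard d (Finset.univ : Finset I)).filter
      (fun S => ¬ (2 ≤ (S ∩ A).card ∧ 2 ≤ (S ∩ B).card)) =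
      ((Finset.powersetCard d (Finset.univ : Finset I)).filter
      (fun S => (S ∩ A).card ≤ 1)) ∪ ((Finset.powersetCard d (Finset.univ : Finset I)).filter
      (fun S => (S ∩ B).card ≤ 1)) := by
    rw [← Finset.filter_or]
    apply Finset.filter_congr
    intro S _
    omega
  rw [h4, Finset.card_union_of_disjoint hdis, h1, h2, Finset.card_powersetCard,
    Finset.card_univ] at h3
  rw [← hd, Nat.choose_symm_add, hd, ← h3]
  ring

lemma basis_ι_mul {K V I : Type*} [Field K] [AddCommGroup V] [Module K V] [LinearOrder I]
    (b : Module.Basis I K V) (i : I) (T : Finset I) :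
    ∃ c : K, (i ∉ T → c ≠ 0) ∧
      ι K (b i) * b.ExteriorAlgebra T = c • b.ExteriorAlgebra (insert i T) := by
  have hi : b.ExteriorAlgebra {i} = ι K (b i) := by
    rw [ExteriorAlgebra.basis_apply_ofCard b (n := 1) (by simp), ExteriorAlgebra.ιMulti_family,
      ExteriorAlgebra.ιMulti_apply]
    have : ∀ j, (Set.powersetCard.ofFinEmbEquiv.symm
      (Set.powersetCard.ofCard (s := ({i} : Finset I)) (n := 1) (by simp))) j = i := by
      intro j
      have := (Set.powersetCard.mem_range_ofFinEmbEquiv_symm_iff_mem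
        (Set.powersetCard.ofCard (s := ({i} : Finset I)) (n := 1) (by simp)) _).1 ⟨j, rfl⟩
      exact Finset.mem_singleton.1 this
    simp [this]
  let s : Set.powersetCard I 1 := Set.powersetCard.ofCard (s := ({i} : Finset I)) (by simp)
  let t : Set.powersetCard I T.card := Set.powersetCard.ofCard (s := T) rfl
  by_cases h : i ∈ T
  · refine ⟨0, fun h' => absurd h h', ?_⟩
    have := ExteriorAlgebra.basis_mul_of_not_disjoint b s t (by simpa [s, t] using h)
    rw [zero_smul, ← this, ← hi]
    rfl
  · have hd : Disjoint s.val t.val := by simpa [s, t] using h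
    have := ExteriorAlgebra.basis_mul_of_disjoint b s t hd
    refine ⟨(((Set.powersetCard.permOfDisjoint hd).sign : ℤ) : K), fun _ => ?_, ?_⟩
    · rcases Int.units_eq_one_or (Set.powersetCard.permOfDisjoint hd).sign with e | e <;> simp [e]
    · rw [← hi]
      change b.ExteriorAlgebra s * b.ExteriorAlgebra t = _
      rw [this]
      have e : ((Set.powersetCard.disjUnion hd : Set.powersetCard I _) : Finset I)
          = insert i T := by
        ext x; simp [Set.powersetCard.disjUnion, s, t]
      rw [e, Units.smul_def, Int.cast_smul_eq_zsmul]

lemma Q_eq {K V I : Type*} [Field K] [AddCommGroup V] [Module K V] [LinearOrder I]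
    (b : Module.Basis I K V) (A : Finset I) (d : ℕ) (hd : 2 ≤ d) :
    Q K d (Submodule.span K (b '' A)) = Submodule.span K (b.ExteriorAlgebra ''
      {S | S.card = d ∧ 2 ≤ (S ∩ A).card}) := by
  apply le_antisymm
  · unfold Q
    rw [Submodule.span_le]
    rintro z ⟨x, hx, y, hy, m, hm, rfl⟩
    rw [SetLike.mem_coe]
    rw [← exteriorPower.ιMulti_family_span_fixedDegree_of_span K b.span_eq] at hm
    induction hx using Submodule.span_induction with
    | zero => simp
    | add p q _ _ hp hq => simp only [map_add, add_mul]; exact add_mem hp hq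
    | smul c p _ hp => simp only [map_smul, smul_mul_assoc]; exact Submodule.smul_mem _ _ hp
    | mem x hx =>
    induction hy using Submodule.span_induction with
    | zero => simp
    | add p q _ _ hp hq => simp only [map_add, mul_add, add_mul]; exact add_mem hp hq
    | smul c p _ hp =>
      simp only [map_smul, mul_smul_comm, smul_mul_assoc]; exact Submodule.smul_mem _ _ hp
    | mem y hy =>
    induction hm using Submodule.span_induction with
    | zero => simp
    | add p q _ _ hp hq => simp only [mul_add]; exact add_mem hp hq
    | smul c p _ hp => simp only [mul_smul_comm]; exact Submodule.smul_mem _ _ hp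
    | mem m hm =>
    obtain ⟨i, hi, rfl⟩ := hx
    obtain ⟨j, hj, rfl⟩ := hy
    obtain ⟨T, rfl⟩ := hm
    rw [← ExteriorAlgebra.basis_apply_powersetCard b T]
    have hT : (T : Finset I).card = d - 2 := T.2
    generalize (T : Finset I) = T at hT
    by_cases hij : i = j
    · subst hij; simp
    by_cases hjT : j ∈ T
    · obtain ⟨c, -, hc⟩ := basis_ι_mul b j T
      have : ι K (b j) * b.ExteriorAlgebra T = 0 := by
        rw [Finset.insert_eq_self.2 hjT] at hc
        obtain ⟨c', hc', hc''⟩ := basis_ι_mul b j (T.erase j)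
        rw [Finset.insert_erase hjT] at hc''
        have h0 := hc' (by simp)
        have h3 : ι K (b j) * (c' • b.ExteriorAlgebra T) = 0 := by
          rw [← hc'', ← mul_assoc, ι_sq_zero, zero_mul]
        rw [mul_smul_comm] at h3
        exact (smul_eq_zero.1 h3).resolve_left h0
      rw [mul_assoc, this]; simp
    by_cases hiT : i ∈ T
    · have : ι K (b i) * b.ExteriorAlgebra (insert j T) = 0 := by
        obtain ⟨c', hc', hc''⟩ := basis_ι_mul b i ((insert j T).erase i)
        rw [Finset.insert_erase (by simp [hiT])] at hc''
        have h0 := hc' (by simp)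
        have h3 : ι K (b i) * (c' • b.ExteriorAlgebra (insert j T)) = 0 := by
          rw [← hc'', ← mul_assoc, ι_sq_zero, zero_mul]
        rw [mul_smul_comm] at h3
        exact (smul_eq_zero.1 h3).resolve_left h0
      obtain ⟨c, -, hc⟩ := basis_ι_mul b j T
      rw [mul_assoc, hc, mul_smul_comm, this]; simp
    obtain ⟨c, -, hc⟩ := basis_ι_mul b j T
    obtain ⟨c', -, hc'⟩ := basis_ι_mul b i (insert j T)
    rw [mul_assoc, hc, mul_smul_comm, hc']
    refine Submodule.smul_mem _ _ (Submodule.smul_mem _ _ (Submodule.subset_span ⟨_, ⟨?_, ?_⟩, rfl⟩))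
    · rw [Finset.card_insert_of_notMem (by simp [hij, hiT]), Finset.card_insert_of_notMem hjT]
      omega
    · rw [← Finset.card_pair hij]
      apply Finset.card_le_card
      intro x
      simp at hi hj ⊢
      grind
  · rw [Submodule.span_le]
    rintro _ ⟨S, ⟨hS, h2⟩, rfl⟩
    obtain ⟨i, hi, j, hj, hij⟩ := Finset.one_lt_card.1 h2
    simp only [Finset.mem_inter] at hi hj
    obtain ⟨c, hc, hc'⟩ := basis_ι_mul b j ((S.erase i).erase j)
    obtain ⟨e, he, he'⟩ := basis_ι_mul b i (S.erase i)
    rw [Finset.insert_erase (by simp [hj, Ne.symm hij])] at hc'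
    rw [Finset.insert_erase hi.1] at he'
    have hc := hc (by simp)
    have he := he (by simp)
    have : b.ExteriorAlgebra S = (e⁻¹ * c⁻¹) • (ι K (b i) * ι K (b j) *
        b.ExteriorAlgebra ((S.erase i).erase j)) := by
      rw [mul_assoc, hc', mul_smul_comm, he', smul_smul, smul_smul]
      rw [show e⁻¹ * c⁻¹ * c * e = 1 by field_simp, one_smul]
    rw [this]
    refine Submodule.smul_mem _ _ (Submodule.subset_span
      ⟨_, Submodule.subset_span ⟨i, hi.2, rfl⟩, _, Submodule.subset_span ⟨j, hj.2, rfl⟩, _, ?_, rfl⟩)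
    have hcard : ((S.erase i).erase j).card = d - 2 := by
      rw [Finset.card_erase_of_mem (by simp [hj, Ne.symm hij]), Finset.card_erase_of_mem hi.1]
      omega
    rw [ExteriorAlgebra.basis_apply_ofCard b hcard,
      ← exteriorPower.ιMulti_family_span_fixedDegree_of_span K b.span_eq]
    exact Submodule.subset_span ⟨_, rfl⟩

lemma exists_adapted {K V : Type*} [Field K] [AddCommGroup V] [Module K V]
    [FiniteDimensional K V] {N : ℕ} (hV : Module.finrank K V = N) (k : ℕ)
    (H₁ H₂ : Submodule K V) (hH₁ : Module.finrank K H₁ = k)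
    (hH₂ : Module.finrank K H₂ = k) (hdisj : H₁ ⊓ H₂ = ⊥) :
    ∃ (b : Module.Basis (Fin N) K V) (A B : Finset (Fin N)), A.card = k ∧ B.card = k ∧
      Disjoint A B ∧ H₁ = Submodule.span K (b '' A) ∧ H₂ = Submodule.span K (b '' B) := by
  classical
  let b1 := Module.finBasisOfFinrankEq K H₁ hH₁
  let b2 := Module.finBasisOfFinrankEq K H₂ hH₂
  let v1 : Fin k → V := fun i => (b1 i : V)
  let v2 : Fin k → V := fun i => (b2 i : V)
  have s1 : Submodule.span K (Set.range v1) = H₁ := by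
    have : Set.range v1 = H₁.subtype '' Set.range b1 := by
      rw [← Set.range_comp]; rfl
    rw [this, Submodule.span_image, b1.span_eq, Submodule.map_top, Submodule.range_subtype]
  have s2 : Submodule.span K (Set.range v2) = H₂ := by
    have : Set.range v2 = H₂.subtype '' Set.range b2 := by
      rw [← Set.range_comp]; rfl
    rw [this, Submodule.span_image, b2.span_eq, Submodule.map_top, Submodule.range_subtype]
  have l1 : LinearIndependent K v1 :=
    b1.linearIndependent.map' H₁.subtype (Submodule.ker_subtype _)
  have l2 : LinearIndependent K v2 :=
    b2.linearIndependent.map' H₂.subtype (Submodule.ker_subtype _)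
  have li : LinearIndependent K (Sum.elim v1 v2) :=
    l1.sum_type l2 (by rw [s1, s2]; exact disjoint_iff.2 hdisj)
  let b' := Module.Basis.sumExtend li
  have hb' : ∀ i, b' (Sum.inl i) = Sum.elim v1 v2 i := fun i => by
    simp [b', Module.Basis.sumExtend]
    rfl
  let e := b'.indexEquiv (Module.finBasisOfFinrankEq K V hV)
  let f1 : Fin k ↪ Fin N := ⟨fun i => e (Sum.inl (Sum.inl i)), fun i j h => by simpa using h⟩
  let f2 : Fin k ↪ Fin N := ⟨fun i => e (Sum.inl (Sum.inr i)), fun i j h => by simpa using h⟩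
  refine ⟨b'.reindex e, Finset.univ.map f1, Finset.univ.map f2, by simp, by simp, ?_, ?_, ?_⟩
  · rw [Finset.disjoint_left]
    intro x hx hx'
    simp only [Finset.mem_map, Finset.mem_univ, true_and] at hx hx'
    obtain ⟨i, rfl⟩ := hx
    obtain ⟨j, hj⟩ := hx'
    have := e.injective hj
    simp at this
  · rw [← s1, Finset.coe_map, Finset.coe_univ, Set.image_univ, ← Set.range_comp]
    congr 2
    ext i
    have : (b'.reindex e) (f1 i) = v1 i := by
      rw [Module.Basis.reindex_apply]
      exact (congrArg b' (e.symm_apply_apply _)).trans (hb' _)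
    exact this.symm
  · rw [← s2, Finset.coe_map, Finset.coe_univ, Set.image_univ, ← Set.range_comp]
    congr 2
    ext i
    have : (b'.reindex e) (f2 i) = v2 i := by
      rw [Module.Basis.reindex_apply]
      exact (congrArg b' (e.symm_apply_apply _)).trans (hb' _)
    exact this.symm

/-- For `k ≥ 3` with `2k ≤ n + 1` and any two `k`-dimensional subspaces `H₁, H₂` of the
`(n+1)`-dimensional space `V` with `H₁ ∩ H₂ = 0`, the intersection
`Q_(n+1-k)(H₁) ∩ Q_(n+1-k)(H₂)` has dimension `max{C(n+1, k) - 2(k(n+1-k) + 1), 0}`. -/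
theorem stmt9 {K V : Type*} [Field K] [CharZero K] [AddCommGroup V] [Module K V]
    [FiniteDimensional K V] {n : ℕ} (hV : Module.finrank K V = n + 1)
    (k : ℕ) (hk : 3 ≤ k) (hkn : 2 * k ≤ n + 1)
    (H₁ H₂ : Submodule K V) (hH₁ : Module.finrank K H₁ = k)
    (hH₂ : Module.finrank K H₂ = k) (hdisj : H₁ ⊓ H₂ = ⊥) :
    (Module.finrank K ↥(Q K (n + 1 - k) H₁ ⊓ Q K (n + 1 - k) H₂) : ℤ) =
      max ((Nat.choose (n + 1) k : ℤ) - 2 * (k * (n + 1 - k) + 1)) 0 := by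
  obtain ⟨b, A, B, hA, hB, hAB, rfl, rfl⟩ := exists_adapted hV k H₁ H₂ hH₁ hH₂ hdisj
  obtain ⟨d, hd⟩ : ∃ d, n + 1 = k + d := ⟨n + 1 - k, by omega⟩
  have hdd : n + 1 - k = d := by omega
  rw [hdd, Q_eq b A d (by omega), Q_eq b B d (by omega)]
  have hcount := card_good A B k d hA hB hAB hk (by simp [hd]) (by omega)
  set F := (Finset.powersetCard d (Finset.univ : Finset (Fin (n + 1)))).filter
      (fun S => 2 ≤ (S ∩ A).card ∧ 2 ≤ (S ∩ B).card) with hF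
  have hinf : Submodule.span K (b.ExteriorAlgebra '' {S | S.card = d ∧ 2 ≤ (S ∩ A).card}) ⊓
      Submodule.span K (b.ExteriorAlgebra '' {S | S.card = d ∧ 2 ≤ (S ∩ B).card}) =
      Submodule.span K (Set.range (fun S : F => b.ExteriorAlgebra S)) := by
    have hr : Set.range (fun S : F => b.ExteriorAlgebra S) = b.ExteriorAlgebra ''
        ({S | S.card = d ∧ 2 ≤ (S ∩ A).card} ∩ {S | S.card = d ∧ 2 ≤ (S ∩ B).card}) := by
      ext z
      simp [hF]
      grind
    rw [hr]
    ext z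
    rw [Submodule.mem_inf, Module.Basis.mem_span_image, Module.Basis.mem_span_image,
      Module.Basis.mem_span_image, Set.subset_inter_iff]
  have hli : LinearIndependent K (fun S : F => b.ExteriorAlgebra S) :=
    b.ExteriorAlgebra.linearIndependent.comp _ Subtype.val_injective
  rw [hinf, finrank_span_eq_card hli, Fintype.card_coe]
  have hz : ((n : ℤ) + 1 - k) = d := by omega
  rw [hz]
  simp only [Fintype.card_fin] at hcount
  rw [← hcount]
  push_cast
  rw [max_eq_left] <;> simp
end

section
/- Let V be a 7-dimensional vector space over an algebraically closed field K of characteristic zero. For every three 3-dimensional linear subspaces H_1, H_2, H_3 of V, the intersection Q_4(H_1) ∩ Q_4(H_2) ∩ Q_4(H_3) inside ⋀^4 V is nonzero (has dimension at least 1). -/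
open ExteriorAlgebra

section helpers
variable {K V : Type*} [Field K] [AddCommGroup V] [Module K V]

theorem aux_ne_zero (b : Fin 4 → V) (hb : LinearIndependent K b) :
    ExteriorAlgebra.ιMulti K 4 b ≠ 0 := by
  have h := exteriorPower.ιMulti_family_linearIndependent_field (n := 4) hb
  have h2 := h.ne_zero (Set.powersetCard.ofFinEmbEquiv (RelEmbedding.refl _))
  intro h0
  apply h2
  apply Subtype.ext
  rw [exteriorPower.ιMulti_family_apply_coe]
  simp only [ExteriorAlgebra.ιMulti_family, Equiv.symm_apply_apply]
  exact h0

theorem aux_alt {U N : Type*} [AddCommGroup U] [Module K U] [AddCommGroup N] [Module K N]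
    (e : Module.Basis (Fin 4) K U) (f : U [⋀^Fin 4]→ₗ[K] N) (b : Fin 4 → U) :
    f b = e.det b • f e := by
  have : f = (LinearMap.toSpanSingleton K N (f e)).compAlternatingMap e.det := by
    apply Module.Basis.ext_alternating e
    intro v hv
    have hσ := Finite.injective_iff_bijective.mp hv
    have h1 := f.map_perm e (Equiv.ofBijective v hσ)
    have h2 := e.det.map_perm e (Equiv.ofBijective v hσ)
    have h3 : (fun i => e (v i)) = e ∘ (Equiv.ofBijective v hσ) := rfl
    rw [h3, LinearMap.compAlternatingMap_apply, h1, h2]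
    simp [e.det_self]
  conv_lhs => rw [this]
  simp

theorem aux_mem (U H : Submodule K V) (hU : Module.finrank K U = 4) (b : Fin 4 → U)
    (x y : V) (hx : x ∈ H) (hy : y ∈ H) (hxU : x ∈ U) (hyU : y ∈ U)
    (hxy : LinearIndependent K ![x, y]) :
    ExteriorAlgebra.ιMulti K 4 (fun i => (b i : V)) ∈ Q K 4 H := by
  have hli : LinearIndependent K ![(⟨x, hxU⟩ : U), ⟨y, hyU⟩] := by
    apply LinearIndependent.of_comp U.subtype
    convert hxy using 1
    ext i; fin_cases i <;> rfl
  obtain ⟨z, hz⟩ := exists_linearIndependent_snoc_of_lt_finrank hli (by omega)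
  obtain ⟨w, hw⟩ := exists_linearIndependent_snoc_of_lt_finrank hz (by omega)
  have : Nonempty (Fin 4) := ⟨0⟩
  let e := basisOfLinearIndependentOfCardEqFinrank hw (by simp [hU])
  have he : (e : Fin 4 → U) = _ := coe_basisOfLinearIndependentOfCardEqFinrank hw (by simp [hU])
  have key := aux_alt e ((ExteriorAlgebra.ιMulti K 4).compLinearMap U.subtype) b
  have hk : ExteriorAlgebra.ιMulti K 4 (fun i => (b i : V)) =
    e.det b • ExteriorAlgebra.ιMulti K 4 (fun i => (e i : V)) := key
  rw [hk]
  apply Submodule.smul_mem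
  apply Submodule.subset_span
  refine ⟨x, hx, y, hy, ExteriorAlgebra.ιMulti K 2 ![(z : V), w],
    ExteriorAlgebra.ιMulti_range K 2 ⟨_, rfl⟩, ?_⟩
  rw [he]
  simp only [ExteriorAlgebra.ιMulti_apply]
  simp [List.ofFn_succ, Fin.snoc, mul_assoc]

/-- `U` meets `H` in dimension at least two. -/
def Meets (K : Type*) {V : Type*} [Field K] [AddCommGroup V] [Module K V]
    (U H : Submodule K V) : Prop :=
  ∃ x y : V, x ∈ H ∧ y ∈ H ∧ x ∈ U ∧ y ∈ U ∧ LinearIndependent K ![x, y]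

theorem aux_extend [FiniteDimensional K V] (hV : Module.finrank K V = 7) (n : ℕ) :
    ∀ U : Submodule K V, Module.finrank K U + n = 4 → ∃ U', U ≤ U' ∧ Module.finrank K U' = 4 := by
  induction n with
  | zero => intro U hU; exact ⟨U, le_rfl, hU⟩
  | succ n ih =>
    intro U hU
    have : U ≠ ⊤ := by
      rintro rfl
      rw [finrank_top] at hU
      omega
    obtain ⟨v, hv⟩ : ∃ v, v ∉ U := by
      by_contra! h
      exact this (eq_top_iff.mpr fun v _ => h v)
    obtain ⟨U', h1, h2⟩ := ih (U ⊔ Submodule.span K {v}) (by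
      rw [Submodule.finrank_sup_span_singleton hv]; omega)
    exact ⟨U', le_sup_left.trans h1, h2⟩

theorem aux_final [FiniteDimensional K V] (hV : Module.finrank K V = 7)
    (H₁ H₂ H₃ : Submodule K V)
    (h : ∃ a b c d : V, Meets K (Submodule.span K {a, b, c, d}) H₁ ∧
      Meets K (Submodule.span K {a, b, c, d}) H₂ ∧ Meets K (Submodule.span K {a, b, c, d}) H₃) :
    Q K 4 H₁ ⊓ Q K 4 H₂ ⊓ Q K 4 H₃ ≠ ⊥ := by
  classical
  obtain ⟨a, b, c, d, h1, h2, h3⟩ := h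
  have hle : Module.finrank K (Submodule.span K {a, b, c, d}) ≤ 4 := by
    have := finrank_span_finset_le_card (R := K) ({a, b, c, d} : Finset V)
    push_cast at this
    exact this.trans Finset.card_le_four
  obtain ⟨U, hU, hU4⟩ := aux_extend hV (4 - Module.finrank K (Submodule.span K {a, b, c, d}))
    (Submodule.span K {a, b, c, d}) (by omega)
  let e := Module.finBasisOfFinrankEq K U hU4
  have key : ∀ H, Meets K (Submodule.span K {a, b, c, d}) H →
      ExteriorAlgebra.ιMulti K 4 (fun i => (e i : V)) ∈ Q K 4 H := by
    rintro H ⟨x, y, hx, hy, hxU, hyU, hxy⟩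
    exact aux_mem U H hU4 e x y hx hy (hU hxU) (hU hyU) hxy
  rw [Submodule.ne_bot_iff]
  refine ⟨_, ⟨⟨key _ h1, key _ h2⟩, key _ h3⟩, aux_ne_zero _ ?_⟩
  exact e.linearIndependent.map' U.subtype (Submodule.ker_subtype U)

theorem aux_ext1 (H : Submodule K V) (hH : 1 < Module.finrank K H) (x : V) (hx : x ∈ H)
    (h0 : x ≠ 0) : ∃ y ∈ H, LinearIndependent K ![x, y] := by
  obtain ⟨y, hy⟩ := exists_linearIndependent_pair_of_one_lt_finrank hH
    (x := (⟨x, hx⟩ : H)) (by simpa using h0)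
  refine ⟨y, y.2, ?_⟩
  have := hy.map' H.subtype (Submodule.ker_subtype H)
  have e : ![x, (y : V)] = H.subtype ∘ ![(⟨x, hx⟩ : H), y] := by
    ext i; fin_cases i <;> rfl
  rw [e]
  exact this

theorem aux_ext2 (H : Submodule K V) (hH : 1 < Module.finrank K H) :
    ∃ x ∈ H, ∃ y ∈ H, LinearIndependent K ![x, y] := by
  have : H ≠ ⊥ := by
    rintro rfl
    simp at hH
  obtain ⟨x, hx, h0⟩ := (Submodule.ne_bot_iff _).mp this
  obtain ⟨y, hy, h⟩ := aux_ext1 H hH x hx h0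
  exact ⟨x, hx, y, hy, h⟩

theorem aux_notmem (H : Submodule K V) (v h : V) (hv : v ∉ H) (hh : h ∈ H) (h0 : h ≠ 0) :
    LinearIndependent K ![v, h] := by
  rw [LinearIndependent.pair_iff]
  intro s t hst
  have hs : s = 0 := by
    by_contra hs
    apply hv
    have : s • v ∈ H := by
      rw [eq_neg_of_add_eq_zero_left hst]
      exact H.neg_mem (H.smul_mem _ hh)
    exact (H.smul_mem_iff hs).mp this
  subst hs
  simpa [h0] using hst

theorem aux_inf [FiniteDimensional K V] (hV : Module.finrank K V = 7)
    (A B C : Submodule K V) (hA : Module.finrank K A = 3)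
    (hB : Module.finrank K B = 3) (hC : Module.finrank K C = 3) (hAB : A ⊓ B = ⊥) :
    1 < Module.finrank K ((A ⊔ B) ⊓ C : Submodule K V) := by
  have h1 := Submodule.finrank_sup_add_finrank_inf_eq A B
  rw [hAB, finrank_bot] at h1
  have h2 := Submodule.finrank_sup_add_finrank_inf_eq (A ⊔ B) C
  have h3 := Submodule.finrank_le ((A ⊔ B) ⊔ C)
  omega

/-- Common goal predicate. -/
def Good (K : Type*) {V : Type*} [Field K] [AddCommGroup V] [Module K V]
    (H₁ H₂ H₃ : Submodule K V) : Prop :=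
  ∃ a b c d : V, Meets K (Submodule.span K {a, b, c, d}) H₁ ∧
      Meets K (Submodule.span K {a, b, c, d}) H₂ ∧ Meets K (Submodule.span K {a, b, c, d}) H₃

theorem mem_a (a b c d : V) : a ∈ Submodule.span K {a, b, c, d} :=
  Submodule.subset_span (by simp)
theorem mem_b (a b c d : V) : b ∈ Submodule.span K {a, b, c, d} :=
  Submodule.subset_span (by simp)
theorem mem_c (a b c d : V) : c ∈ Submodule.span K {a, b, c, d} :=
  Submodule.subset_span (by simp)
theorem mem_d (a b c d : V) : d ∈ Submodule.span K {a, b, c, d} :=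
  Submodule.subset_span (by simp)

/-- A common vector of `B, C` outside `A`, and a nonzero common vector of `A, B`. -/
theorem good_two (A B C : Submodule K V) (hA : Module.finrank K A = 3)
    (hC : Module.finrank K C = 3) (v h : V) (hvB : v ∈ B) (hvC : v ∈ C) (hvA : v ∉ A)
    (hhA : h ∈ A) (hhB : h ∈ B) (h0 : h ≠ 0) : Good K A B C := by
  obtain ⟨h', hh', hl⟩ := aux_ext1 A (by omega) h hhA h0
  obtain ⟨k, hk, hkl⟩ := aux_ext1 C (by omega) v hvC (fun h => hvA (h ▸ A.zero_mem))
  exact ⟨v, h, h', k, ⟨h, h', hhA, hh', mem_b _ _ _ _, mem_c _ _ _ _, hl⟩,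
    ⟨v, h, hvB, hhB, mem_a _ _ _ _, mem_b _ _ _ _, aux_notmem A v h hvA hhA h0⟩,
    ⟨v, k, hvC, hk, mem_a _ _ _ _, mem_d _ _ _ _, hkl⟩⟩

theorem good_swap {A B C : Submodule K V} (h : Good K A B C) : Good K A C B := by
  obtain ⟨a, b, c, d, h1, h2, h3⟩ := h
  exact ⟨a, b, c, d, h1, h3, h2⟩

theorem good_rot {A B C : Submodule K V} (h : Good K A B C) : Good K B C A := by
  obtain ⟨a, b, c, d, h1, h2, h3⟩ := h
  exact ⟨a, b, c, d, h2, h3, h1⟩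

theorem good_one [FiniteDimensional K V] (hV : Module.finrank K V = 7)
    (A B C : Submodule K V) (hA : Module.finrank K A = 3)
    (hB : Module.finrank K B = 3) (hC : Module.finrank K C = 3) (hBC : B ⊓ C ≠ ⊥) :
    Good K A B C := by
  obtain ⟨v, ⟨hvB, hvC⟩, hv0⟩ := (Submodule.ne_bot_iff _).mp hBC
  obtain ⟨b, hb, hbl⟩ := aux_ext1 B (by omega) v hvB hv0
  obtain ⟨c, hc, hcl⟩ := aux_ext1 C (by omega) v hvC hv0
  by_cases hvA : v ∈ A
  · obtain ⟨a, ha, hal⟩ := aux_ext1 A (by omega) v hvA hv0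
    exact ⟨v, a, b, c, ⟨v, a, hvA, ha, mem_a _ _ _ _, mem_b _ _ _ _, hal⟩,
      ⟨v, b, hvB, hb, mem_a _ _ _ _, mem_c _ _ _ _, hbl⟩,
      ⟨v, c, hvC, hc, mem_a _ _ _ _, mem_d _ _ _ _, hcl⟩⟩
  by_cases hAB : A ⊓ B = ⊥
  swap
  · obtain ⟨h, ⟨hhA, hhB⟩, h0⟩ := (Submodule.ne_bot_iff _).mp hAB
    exact good_two A B C hA hC v h hvB hvC hvA hhA hhB h0
  have h2 := aux_inf hV A B C hA hB hC hAB
  obtain ⟨w, ⟨hwAB, hwC⟩, hw⟩ := aux_ext1 _ h2 v ⟨Submodule.mem_sup_right hvB, hvC⟩ hv0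
  obtain ⟨p, hp, q, hq, rfl⟩ := Submodule.mem_sup.mp hwAB
  by_cases hql : LinearIndependent K ![v, q]
  · by_cases hp0 : p = 0
    · subst hp0
      obtain ⟨x, hx, y, hy, hxy⟩ := aux_ext2 A (by omega)
      rw [zero_add] at hwC
      exact ⟨v, q, x, y, ⟨x, y, hx, hy, mem_c _ _ _ _, mem_d _ _ _ _, hxy⟩,
        ⟨v, q, hvB, hq, mem_a _ _ _ _, mem_b _ _ _ _, hql⟩,
        ⟨v, q, hvC, hwC, mem_a _ _ _ _, mem_b _ _ _ _, hql⟩⟩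
    · obtain ⟨p', hp', hpl⟩ := aux_ext1 A (by omega) p hp hp0
      exact ⟨v, q, p, p', ⟨p, p', hp, hp', mem_c _ _ _ _, mem_d _ _ _ _, hpl⟩,
        ⟨v, q, hvB, hq, mem_a _ _ _ _, mem_b _ _ _ _, hql⟩,
        ⟨v, p + q, hvC, hwC, mem_a _ _ _ _,
          Submodule.add_mem _ (mem_c _ _ _ _) (mem_b _ _ _ _), hw⟩⟩
  · rw [LinearIndependent.pair_iff' hv0] at hql
    push Not at hql
    obtain ⟨t, rfl⟩ := hql
    have hpC : p ∈ C := by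
      have := C.sub_mem hwC (C.smul_mem t hvC)
      rwa [add_sub_cancel_right] at this
    have hp0 : p ≠ 0 := by
      rintro rfl
      rw [LinearIndependent.pair_iff' hv0] at hw
      exact hw t (by simp)
    exact good_swap (good_two A C B hA hB v p hvC hvB hvA hp hpC hp0)

theorem aux_pair (C D : Submodule K V) (hCD : C ⊓ D = ⊥) (x1 x2 y1 y2 : V)
    (h : LinearIndependent K ![x1 + x2, y1 + y2]) (hx : x1 + x2 ∈ C) (hy : y1 + y2 ∈ C)
    (hx2 : x2 ∈ D) (hy2 : y2 ∈ D) : LinearIndependent K ![x1, y1] := by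
  rw [LinearIndependent.pair_iff] at h ⊢
  intro s t hst
  have e : s • (x1 + x2) + t • (y1 + y2) = s • x2 + t • y2 := by
    calc _ = (s • x1 + t • y1) + (s • x2 + t • y2) := by module
      _ = _ := by rw [hst, zero_add]
  apply h
  have : s • (x1 + x2) + t • (y1 + y2) ∈ C ⊓ D := by
    refine ⟨C.add_mem (C.smul_mem _ hx) (C.smul_mem _ hy), ?_⟩
    rw [e]
    exact D.add_mem (D.smul_mem _ hx2) (D.smul_mem _ hy2)
  rwa [hCD, Submodule.mem_bot] at this

theorem good_all [FiniteDimensional K V] (hV : Module.finrank K V = 7)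
    (A B C : Submodule K V) (hA : Module.finrank K A = 3)
    (hB : Module.finrank K B = 3) (hC : Module.finrank K C = 3) :
    Good K A B C := by
  by_cases hBC : B ⊓ C = ⊥
  swap
  · exact good_one hV A B C hA hB hC hBC
  by_cases hCA : C ⊓ A = ⊥
  swap
  · exact good_rot (good_rot (good_one hV B C A hB hC hA hCA))
  by_cases hAB : A ⊓ B = ⊥
  swap
  · exact good_rot (good_one hV C A B hC hA hB hAB)
  obtain ⟨u, ⟨hu, huC⟩, w, ⟨hw, hwC⟩, huw⟩ := aux_ext2 _ (aux_inf hV A B C hA hB hC hAB)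
  obtain ⟨x1, hx1, x2, hx2, rfl⟩ := Submodule.mem_sup.mp hu
  obtain ⟨y1, hy1, y2, hy2, rfl⟩ := Submodule.mem_sup.mp hw
  refine ⟨x1, x2, y1, y2,
    ⟨x1, y1, hx1, hy1, mem_a _ _ _ _, mem_c _ _ _ _,
      aux_pair C B (by rw [inf_comm, hBC]) x1 x2 y1 y2 huw huC hwC hx2 hy2⟩,
    ⟨x2, y2, hx2, hy2, mem_b _ _ _ _, mem_d _ _ _ _, ?_⟩,
    ⟨x1 + x2, y1 + y2, huC, hwC, Submodule.add_mem _ (mem_a _ _ _ _) (mem_b _ _ _ _),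
      Submodule.add_mem _ (mem_c _ _ _ _) (mem_d _ _ _ _), huw⟩⟩
  rw [add_comm x1, add_comm y1] at huw
  rw [add_comm] at huC hwC
  exact aux_pair C A hCA x2 x1 y2 y1 huw huC hwC hx1 hy1

end helpers

/-- For a 7-dimensional space `V` and any three 3-dimensional subspaces `H₁, H₂, H₃`,
the intersection `Q₄(H₁) ∩ Q₄(H₂) ∩ Q₄(H₃)` inside `⋀^4 V` is nonzero. -/
theorem stmt10 {K V : Type*} [Field K] [CharZero K] [IsAlgClosed K]
    [AddCommGroup V] [Module K V] [FiniteDimensional K V]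
    (hV : Module.finrank K V = 7)
    (H₁ H₂ H₃ : Submodule K V) (hH₁ : Module.finrank K H₁ = 3)
    (hH₂ : Module.finrank K H₂ = 3) (hH₃ : Module.finrank K H₃ = 3) :
    Q K 4 H₁ ⊓ Q K 4 H₂ ⊓ Q K 4 H₃ ≠ ⊥ := by
  exact aux_final hV H₁ H₂ H₃ (good_all hV H₁ H₂ H₃ hH₁ hH₂ hH₃)
end

section
/- Let V be a 7-dimensional vector space over an algebraically closed field K of characteristic zero. There exist three 3-dimensional linear subspaces H_1, H_2, H_3 of V such that the intersection Q_4(H_1) ∩ Q_4(H_2) ∩ Q_4(H_3) inside ⋀^4 V has dimension exactly 1. -/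
open ExteriorAlgebra

namespace Stmt11Aux

variable {K V : Type*} [Field K] [AddCommGroup V] [Module K V]

/-- contraction -/
noncomputable abbrev D (d : Module.Dual K V) : ExteriorAlgebra K V →ₗ[K] ExteriorAlgebra K V :=
  CliffordAlgebra.contractLeft (Q := (0 : QuadraticForm K V)) d

lemma D_mul (d : Module.Dual K V) (a : V) (z : ExteriorAlgebra K V) :
    D d (ι K a * z) = d a • z - ι K a * D d z :=
  CliffordAlgebra.contractLeft_ι_mul _ _ _

lemma D_one (d : Module.Dual K V) : D d (1 : ExteriorAlgebra K V) = 0 :=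
  CliffordAlgebra.contractLeft_one _ _

lemma D_comm (d d' : Module.Dual K V) (z : ExteriorAlgebra K V) :
    D d (D d' z) = - D d' (D d z) :=
  CliffordAlgebra.contractLeft_comm _ _ _

lemma D_self (d : Module.Dual K V) (z : ExteriorAlgebra K V) :
    D d (D d z) = 0 :=
  CliffordAlgebra.contractLeft_contractLeft _ _

lemma anti (a c : V) (z : ExteriorAlgebra K V) :
    ι K a * (ι K c * z) = - (ι K c * (ι K a * z)) := by
  have h := ι_add_mul_swap (R := K) a c
  rw [← mul_assoc, ← mul_assoc, eq_neg_of_add_eq_zero_left h, neg_mul]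

lemma sq0 (a : V) (z : ExteriorAlgebra K V) : ι K a * (ι K a * z) = 0 := by
  rw [← mul_assoc, ι_sq_zero, zero_mul]

lemma D_mem (d : Module.Dual K V) (n : ℕ) : ∀ z ∈ ⋀[K]^(n+1) V, D d z ∈ ⋀[K]^n V := by
  induction n with
  | zero =>
    intro z hz
    rw [zero_add, exteriorPower, pow_one] at hz
    obtain ⟨v, rfl⟩ := hz
    have := D_mul d v 1
    rw [mul_one, D_one, mul_zero, sub_zero] at this
    rw [this, exteriorPower, pow_zero]
    exact Submodule.smul_mem _ _ (Submodule.mem_one.mpr ⟨1, map_one _⟩)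
  | succ n ih =>
    intro z hz
    rw [exteriorPower, pow_succ'] at hz
    induction hz using Submodule.mul_induction_on' with
    | mem_mul_mem m hm y hy =>
      obtain ⟨v, rfl⟩ := hm
      rw [D_mul]
      refine Submodule.sub_mem _ (Submodule.smul_mem _ _ hy) ?_
      rw [exteriorPower, pow_succ']
      exact Submodule.mul_mem_mul ⟨v, rfl⟩ (ih y hy)
    | add x hx y hy h1 h2 =>
      rw [map_add]; exact Submodule.add_mem _ h1 h2

/-- projection to monomials not containing `b i` -/
noncomputable def P (b : Module.Basis (Fin 7) K V) (i : Fin 7) :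
    ExteriorAlgebra K V →ₗ[K] ExteriorAlgebra K V :=
  LinearMap.id - (LinearMap.mulLeft K (ι K (b i))) ∘ₗ D (b.coord i)

lemma P_apply (b : Module.Basis (Fin 7) K V) (i : Fin 7) (z : ExteriorAlgebra K V) :
    P b i z = z - ι K (b i) * D (b.coord i) z := by
  simp [P]

lemma coord_ne (b : Module.Basis (Fin 7) K V) {i j : Fin 7} (h : i ≠ j) :
    b.coord i (b j) = 0 := by
  simp [Finsupp.single_apply, h.symm]

lemma coord_self (b : Module.Basis (Fin 7) K V) (i : Fin 7) :
    b.coord i (b i) = 1 := by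
  simp

lemma D_mul_ne (b : Module.Basis (Fin 7) K V) {i j : Fin 7} (h : i ≠ j)
    (z : ExteriorAlgebra K V) :
    D (b.coord i) (ι K (b j) * z) = - (ι K (b j) * D (b.coord i) z) := by
  rw [D_mul, coord_ne b h, zero_smul, zero_sub]

lemma D_mul_self (b : Module.Basis (Fin 7) K V) (i : Fin 7)
    (z : ExteriorAlgebra K V) :
    D (b.coord i) (ι K (b i) * z) = z - (ι K (b i) * D (b.coord i) z) := by
  rw [D_mul, coord_self b, one_smul]

lemma P_mul_ne (b : Module.Basis (Fin 7) K V) {i j : Fin 7} (h : i ≠ j)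
    (z : ExteriorAlgebra K V) :
    P b i (ι K (b j) * z) = ι K (b j) * P b i z := by
  rw [P_apply, P_apply, D_mul_ne b h, mul_neg, anti (b i) (b j), mul_sub]
  abel

lemma P_mul_self (b : Module.Basis (Fin 7) K V) (i : Fin 7)
    (z : ExteriorAlgebra K V) :
    P b i (ι K (b i) * z) = 0 := by
  rw [P_apply, D_mul_self b, mul_sub, sq0]
  abel

lemma mul_P_self (b : Module.Basis (Fin 7) K V) (i : Fin 7)
    (z : ExteriorAlgebra K V) :
    ι K (b i) * P b i z = ι K (b i) * z := by
  rw [P_apply, mul_sub, sq0, sub_zero]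

lemma D_P_ne (b : Module.Basis (Fin 7) K V) {i j : Fin 7} (h : i ≠ j)
    (z : ExteriorAlgebra K V) :
    D (b.coord i) (P b j z) = P b j (D (b.coord i) z) := by
  rw [P_apply, P_apply, map_sub, D_mul_ne b h, D_comm, mul_neg]
  abel

lemma D_P_self (b : Module.Basis (Fin 7) K V) (i : Fin 7)
    (z : ExteriorAlgebra K V) :
    D (b.coord i) (P b i z) = 0 := by
  rw [P_apply, map_sub, D_mul_self b, D_self]; simp

lemma P_comm (b : Module.Basis (Fin 7) K V) (i j : Fin 7)
    (z : ExteriorAlgebra K V) :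
    P b i (P b j z) = P b j (P b i z) := by
  rcases eq_or_ne i j with rfl | h
  · rfl
  rw [P_apply b i, P_apply b i, D_P_ne b h, map_sub, P_mul_ne b h.symm]

lemma P_idem (b : Module.Basis (Fin 7) K V) (i : Fin 7)
    (z : ExteriorAlgebra K V) :
    P b i (P b i z) = P b i z := by
  rw [P_apply b i (P b i z), D_P_self, mul_zero, sub_zero]

lemma P_P_zero (b : Module.Basis (Fin 7) K V) {i j : Fin 7} (h : i ≠ j)
    (z : ExteriorAlgebra K V) (hz : ι K (b i) * (ι K (b j) * z) = 0) :
    P b i (P b j z) = 0 := by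
  have h1 : ∀ i w, P b i w = D (b.coord i) (ι K (b i) * w) := by
    intro i w; rw [P_apply, D_mul_self]
  rw [h1 j, ← D_P_ne b h.symm, h1 i, hz, map_zero, map_zero]

lemma euler (b : Module.Basis (Fin 7) K V) (n : ℕ) :
    ∀ z ∈ ⋀[K]^n V, ∑ i, ι K (b i) * D (b.coord i) z = (n : K) • z := by
  induction n with
  | zero =>
    intro z hz
    rw [exteriorPower, pow_zero] at hz
    obtain ⟨c, rfl⟩ := Submodule.mem_one.mp hz
    simp [Algebra.algebraMap_eq_smul_one, D_one]
  | succ n ih =>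
    intro z hz
    rw [exteriorPower, pow_succ'] at hz
    induction hz using Submodule.mul_induction_on' with
    | mem_mul_mem m hm y hy =>
      obtain ⟨v, rfl⟩ := hm
      have h1 : ∀ i, ι K (b i) * D (b.coord i) (ι K v * y) =
          ι K (b.coord i v • b i) * y + ι K v * (ι K (b i) * D (b.coord i) y) := by
        intro i
        rw [D_mul, mul_sub, anti (b i) v, map_smul]
        simp
      simp_rw [h1]
      rw [Finset.sum_add_distrib, ← Finset.mul_sum, ih y hy, ← Finset.sum_mul, ← map_sum]
      have h2 : ∑ i, b.coord i v • b i = v := b.sum_repr v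
      rw [h2, Nat.cast_succ, add_smul, one_smul, mul_smul_comm, add_comm]
    | add x hx y hy h1 h2 =>
      simp only [map_add, mul_add, Finset.sum_add_distrib, smul_add]
      rw [h1, h2]

lemma four_zero (H : Submodule K V) [FiniteDimensional K V] (hH : Module.finrank K H = 3)
    (a c x y : V) (ha : a ∈ H) (hc : c ∈ H) (hx : x ∈ H) (hy : y ∈ H) :
    ι K a * (ι K c * (ι K x * ι K y)) = 0 := by
  have h : ¬ LinearIndependent K ![a, c, x, y] := by
    intro hl
    have h2 : LinearIndependent K (![⟨a, ha⟩, ⟨c, hc⟩, ⟨x, hx⟩, ⟨y, hy⟩] : Fin 4 → H) := by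
      apply LinearIndependent.of_comp H.subtype
      convert hl using 1
      ext i; fin_cases i <;> rfl
    have := h2.fintype_card_le_finrank
    simp [hH] at this
  have := AlternatingMap.map_linearDependent (ιMulti K 4) ![a, c, x, y] h
  rw [ιMulti_apply] at this
  simpa [List.ofFn_succ, Fin.succ] using this

lemma Q_zero (H : Submodule K V) [FiniteDimensional K V] (hH : Module.finrank K H = 3)
    (a c : V) (ha : a ∈ H) (hc : c ∈ H) (z : ExteriorAlgebra K V) (hz : z ∈ Q K 4 H) :
    ι K a * (ι K c * z) = 0 := by
  induction hz using Submodule.span_induction with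
  | mem z h =>
    obtain ⟨x, hx, y, hy, m, hm, rfl⟩ := h
    have := four_zero H hH a c x y ha hc hx hy
    simp only [← mul_assoc] at this ⊢
    rw [this, zero_mul]
  | zero => simp
  | add x y _ _ h1 h2 => rw [mul_add, mul_add, h1, h2, add_zero]
  | smul t x _ h => rw [mul_smul_comm, mul_smul_comm, h, smul_zero]

lemma Q_deg (H : Submodule K V) (z : ExteriorAlgebra K V) (hz : z ∈ Q K 4 H) :
    z ∈ ⋀[K]^4 V := by
  refine (Submodule.span_le.mpr ?_) hz
  rintro _ ⟨x, hx, y, hy, m, hm, rfl⟩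
  change m ∈ (LinearMap.range (ι K (M := V))) ^ 2 at hm
  change _ ∈ (LinearMap.range (ι K (M := V))) ^ (2 + 2)
  rw [pow_add]
  refine Submodule.mul_mem_mul ?_ hm
  rw [pow_two]
  exact Submodule.mul_mem_mul ⟨x, rfl⟩ ⟨y, rfl⟩

lemma abs_pqr [CharZero K] {E : Type*} [AddCommGroup E] [Module K E] (p q r : E →ₗ[K] E)
    (hpq : ∀ z, p (q z) = q (p z)) (hpr : ∀ z, p (r z) = r (p z)) (hqr : ∀ z, q (r z) = r (q z))
    (z : E) (hp : p (p z) = p z) (hq : q (q z) = q z) (hr : r (r z) = r z)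
    (hs : p z + q z + r z = (3 : K) • z) : p z = z ∧ r z = z := by
  have key : ∀ (p q r : E →ₗ[K] E) (_ : ∀ z, p (q z) = q (p z)) (_ : ∀ z, p (r z) = r (p z))
    (_ : ∀ z, q (r z) = r (q z))
    (_ : p (p z) = p z) (_ : q (q z) = q z) (_ : r (r z) = r z)
    (_ : p z + q z + r z = (3 : K) • z), p z = z := by
    clear hpq hpr hqr hp hq hr hs p q r
    intro p q r hpq hpr hqr hp hq hr hs
    obtain ⟨u, hu⟩ : ∃ u, u = z - p z := ⟨_, rfl⟩
    have pu : p u = 0 := by rw [hu, map_sub, hp, sub_self]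
    have qu : q (q u) = q u := by rw [hu, map_sub, map_sub, ← hpq, ← hpq, hq]
    have ru : r (r u) = r u := by rw [hu, map_sub, map_sub, ← hpr, ← hpr, hr]
    have su : q u + r u = (3 : K) • u := by
      have h2 := congrArg p hs
      simp only [map_add, map_smul] at h2
      have : q u + r u = (p z + q z + r z) - (p (p z) + p (q z) + p (r z)) := by
        rw [hu, map_sub, map_sub, hpq, hpr, hp]; abel
      rw [this, h2, hs, hu, smul_sub]
    have s1 := congrArg q su
    have s2 := congrArg r su
    simp only [map_add, map_smul, qu, ru, hqr] at s1 s2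
    -- q u + rq u = 3 q u ; rq u + r u = 3 r u
    have s3 := congrArg r s1
    have ru2 : r (r (q u)) = r (q u) := by rw [← hqr, ← hqr, ru]
    simp only [map_add, map_smul, ru2] at s3
    have t1 : r (q u) = 0 := by
      have : (1 : K) • r (q u) = 0 := by linear_combination (norm := module) -s3
      simpa using this
    rw [t1] at s1 s2
    have t2 : q u = 0 := by
      have : (2 : K) • q u = 0 := by linear_combination (norm := module) -s1
      simpa using this
    have t3 : r u = 0 := by
      have : (2 : K) • r u = 0 := by linear_combination (norm := module) -s2
      simpa using this
    rw [t2, t3, add_zero] at su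
    have : u = 0 := by simpa using su.symm
    rw [this] at hu
    exact (sub_eq_zero.mp hu.symm).symm
  refine ⟨key p q r hpq hpr hqr hp hq hr hs,
    key r q p (fun z => (hqr z).symm) (fun z => (hpr z).symm) (fun z => (hpq z).symm) hr hq hp ?_⟩
  rw [← hs]; abel

lemma triple_idem (b : Module.Basis (Fin 7) K V) (i j k : Fin 7) (hij : i ≠ j) (hik : i ≠ k)
    (hjk : j ≠ k) (z : ExteriorAlgebra K V)
    (h : ∀ s t, (s = i ∨ s = j ∨ s = k) → (t = i ∨ t = j ∨ t = k) →
      ι K (b s) * (ι K (b t) * z) = 0) :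
    (P b i + P b j + P b k) ((P b i + P b j + P b k) z) = (P b i + P b j + P b k) z := by
  have h1 := P_P_zero b hij z (h _ _ (by simp) (by simp))
  have h2 := P_P_zero b hik z (h _ _ (by simp) (by simp))
  have h3 := P_P_zero b hjk z (h _ _ (by simp) (by simp))
  have h4 := P_P_zero b hij.symm z (h _ _ (by simp) (by simp))
  have h5 := P_P_zero b hik.symm z (h _ _ (by simp) (by simp))
  have h6 := P_P_zero b hjk.symm z (h _ _ (by simp) (by simp))
  simp only [LinearMap.add_apply, map_add, h1, h2, h3, h4, h5, h6, P_idem]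
  abel

lemma kill (b : Module.Basis (Fin 7) K V) (i i' j k l : Fin 7)
    (hij : i ≠ j) (hik : i ≠ k) (hjk : j ≠ k) (hil : i ≠ l) (hjl : j ≠ l) (hkl : k ≠ l)
    (z : ExteriorAlgebra K V) (hi' : i' = i)
    (hz : P b i z + P b j z + P b k z = z)
    (h : ι K (b i' + b l) * z = 0) : ι K (b i) * z = 0 ∧ ι K (b l) * z = 0 := by
  subst hi'
  rw [map_add, add_mul] at h
  have h1 := congrArg (P b i' + P b j + P b k) h
  simp only [LinearMap.add_apply, map_add, map_zero, P_mul_self, P_mul_ne b hij.symm,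
    P_mul_ne b hik.symm, P_mul_ne b hil, P_mul_ne b hjl, P_mul_ne b hkl] at h1
  have h2 : ι K (b i') * P b j z + ι K (b i') * P b k z = 0 := by
    have := congrArg (ι K (b i') * ·) hz
    simp only [mul_add, mul_P_self] at this
    rw [add_assoc] at this
    exact left_eq_add.mp this.symm
  have h3 : ι K (b l) * P b i' z + ι K (b l) * P b j z + ι K (b l) * P b k z = ι K (b l) * z := by
    rw [← mul_add, ← mul_add, hz]
  have h4 : ι K (b l) * z = 0 := by
    rw [← h3, ← h1]
    linear_combination (norm := module) -h2
  rw [h4, add_zero] at h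
  exact ⟨h, h4⟩

lemma divide (b : Module.Basis (Fin 7) K V) (i : Fin 7) (z : ExteriorAlgebra K V)
    (h : ι K (b i) * z = 0) : z = ι K (b i) * D (b.coord i) z := by
  have := D_mul_self b i z
  rw [h, map_zero] at this
  exact sub_eq_zero.mp this.symm

lemma D_kill (b : Module.Basis (Fin 7) K V) {i j : Fin 7} (hij : i ≠ j) (z : ExteriorAlgebra K V)
    (h : ι K (b j) * z = 0) : ι K (b j) * D (b.coord i) z = 0 := by
  have := D_mul_ne b hij z
  rw [h, map_zero] at this
  exact neg_eq_zero.mp this.symm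

lemma main [CharZero K] (b : Module.Basis (Fin 7) K V) (z : ExteriorAlgebra K V)
    (hdeg : z ∈ ⋀[K]^4 V)
    (h1 : ∀ s t : Fin 7, (s = 0 ∨ s = 1 ∨ s = 2) → (t = 0 ∨ t = 1 ∨ t = 2) →
      ι K (b s) * (ι K (b t) * z) = 0)
    (h2 : ∀ s t : Fin 7, (s = 3 ∨ s = 4 ∨ s = 5) → (t = 3 ∨ t = 4 ∨ t = 5) →
      ι K (b s) * (ι K (b t) * z) = 0)
    (h3 : ι K (b 6) * (ι K (b 0 + b 3) * z) = 0)
    (h4 : ι K (b 6) * (ι K (b 1 + b 4) * z) = 0) :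
    ∃ c : K, z = c • (ι K (b 0) * (ι K (b 1) * (ι K (b 3) * ι K (b 4)))) := by
  obtain ⟨hp, hr⟩ := abs_pqr (K := K) (P b 0 + P b 1 + P b 2) (P b 3 + P b 4 + P b 5) (P b 6)
    (by intro z; simp only [LinearMap.add_apply, map_add, P_comm b 0, P_comm b 1, P_comm b 2]; abel)
    (by intro z; simp only [LinearMap.add_apply, map_add, P_comm b 0, P_comm b 1, P_comm b 2])
    (by intro z; simp only [LinearMap.add_apply, map_add, P_comm b 3, P_comm b 4, P_comm b 5])
    z (triple_idem b 0 1 2 (by decide) (by decide) (by decide) z h1)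
    (triple_idem b 3 4 5 (by decide) (by decide) (by decide) z h2) (P_idem b 6 z)
    (by
      have := euler b 4 z hdeg
      simp only [Fin.sum_univ_seven] at this
      simp only [LinearMap.add_apply, P_apply]
      push_cast at this
      linear_combination (norm := module) -this)
  have d6 : D (b.coord 6) z = 0 := by rw [← hr, D_P_self]
  have aux : ∀ v : V, b.coord 6 v = 0 → ι K (b 6) * (ι K v * z) = 0 → ι K v * z = 0 := by
    intro v hv h
    rw [divide b 6 _ h, D_mul, hv, d6]; simp
  have f0 := aux (b 0 + b 3) (by rw [map_add, coord_ne b (by decide), coord_ne b (by decide), add_zero]) h3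
  have g0 := aux (b 1 + b 4) (by rw [map_add, coord_ne b (by decide), coord_ne b (by decide), add_zero]) h4
  simp only [LinearMap.add_apply] at hp
  obtain ⟨k0, k3⟩ := kill b 0 0 1 2 3 (by decide) (by decide) (by decide) (by decide) (by decide)
    (by decide) z rfl hp f0
  obtain ⟨k1, k4⟩ := kill b 1 1 0 2 4 (by decide) (by decide) (by decide) (by decide) (by decide)
    (by decide) z rfl (by rw [add_comm (P b 1 z)]; exact hp) g0
  have e0 := divide b 0 z k0
  have e1 := divide b 1 _ (D_kill b (i := 0) (by decide) _ k1)
  have e3 := divide b 3 _ (D_kill b (i := 1) (by decide) _ (D_kill b (i := 0) (by decide) _ k3))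
  have e4 := divide b 4 _ (D_kill b (i := 3) (by decide) _
    (D_kill b (i := 1) (by decide) _ (D_kill b (i := 0) (by decide) _ k4)))
  have hs := D_mem (b.coord 4) 0 _ (D_mem (b.coord 3) 1 _ (D_mem (b.coord 1) 2 _
    (D_mem (b.coord 0) 3 _ hdeg)))
  rw [exteriorPower, pow_zero] at hs
  obtain ⟨c, hc⟩ := Submodule.mem_one.mp hs
  refine ⟨c, ?_⟩
  rw [← hc, Algebra.algebraMap_eq_smul_one, mul_smul_comm, mul_one] at e4
  rw [e4] at e3
  rw [e3] at e1
  rw [e1] at e0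
  rw [e0]
  simp only [mul_smul_comm]

lemma w_ne (b : Module.Basis (Fin 7) K V) :
    ι K (b 0) * (ι K (b 1) * (ι K (b 3) * ι K (b 4))) ≠ 0 := by
  intro h
  have h4 : ι K (b 4) = ι K (b 4) * (1 : ExteriorAlgebra K V) := (mul_one _).symm
  have h' := congrArg (fun z => D (b.coord 4) (D (b.coord 3) (D (b.coord 1) (D (b.coord 0) z)))) h
  rw [h4] at h'
  have n1 : (0 : Fin 7) ≠ 1 := by decide
  have n2 : (0 : Fin 7) ≠ 3 := by decide
  have n3 : (0 : Fin 7) ≠ 4 := by decide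
  have n4 : (1 : Fin 7) ≠ 3 := by decide
  have n5 : (1 : Fin 7) ≠ 4 := by decide
  have n6 : (3 : Fin 7) ≠ 4 := by decide
  simp only [D_mul_self, D_mul_ne b n1, D_mul_ne b n2, D_mul_ne b n3, D_mul_ne b n4,
    D_mul_ne b n5, D_mul_ne b n6, D_one, mul_zero, neg_zero, sub_zero, map_zero] at h'
  exact one_ne_zero h'

lemma mem2 (x y : V) : ι K x * ι K y ∈ ⋀[K]^(4-2) V := by
  have : (4 - 2 : ℕ) = 1 + 1 := rfl
  rw [this, exteriorPower, pow_add, pow_one]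
  exact Submodule.mul_mem_mul ⟨x, rfl⟩ ⟨y, rfl⟩

end Stmt11Aux

open Stmt11Aux in
/-- For a 7-dimensional space `V` there exist three 3-dimensional subspaces
`H₁, H₂, H₃` with `dim (Q₄(H₁) ∩ Q₄(H₂) ∩ Q₄(H₃)) = 1`. -/
theorem stmt11 {K V : Type*} [Field K] [CharZero K] [IsAlgClosed K]
    [AddCommGroup V] [Module K V] [FiniteDimensional K V]
    (hV : Module.finrank K V = 7) :
    ∃ H₁ H₂ H₃ : Submodule K V,
      Module.finrank K H₁ = 3 ∧ Module.finrank K H₂ = 3 ∧ Module.finrank K H₃ = 3 ∧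
      Module.finrank K ↥(Q K 4 H₁ ⊓ Q K 4 H₂ ⊓ Q K 4 H₃) = 1 := by
  let b : Module.Basis (Fin 7) K V := Module.finBasisOfFinrankEq K V hV
  have hfr : ∀ v : Fin 3 → V, LinearIndependent K v →
      Module.finrank K (Submodule.span K (Set.range v)) = 3 := by
    intro v hv
    rw [finrank_span_eq_card hv, Fintype.card_fin]
  have l1 : LinearIndependent K ![b 0, b 1, b 2] := by
    convert b.linearIndependent.comp ![0, 1, 2] (by decide) using 1
    ext i; fin_cases i <;> rfl
  have l2 : LinearIndependent K ![b 3, b 4, b 5] := by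
    convert b.linearIndependent.comp ![3, 4, 5] (by decide) using 1
    ext i; fin_cases i <;> rfl
  have l3 : LinearIndependent K ![b 0 + b 3, b 1 + b 4, b 6] := by
    rw [Fintype.linearIndependent_iff]
    intro g hg
    simp only [Fin.sum_univ_three] at hg
    have c0 := congrArg (b.coord 0) hg
    have c1 := congrArg (b.coord 1) hg
    have c6 := congrArg (b.coord 6) hg
    simp [Finsupp.single_apply] at c0 c1 c6
    intro i; fin_cases i
    · exact c0
    · exact c1
    · exact c6
  have f1 := hfr _ l1
  have f2 := hfr _ l2
  have f3 := hfr _ l3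
  have m1 : ∀ i, ![b 0, b 1, b 2] i ∈ Submodule.span K (Set.range ![b 0, b 1, b 2]) :=
    fun i => Submodule.subset_span ⟨i, rfl⟩
  have m2 : ∀ i, ![b 3, b 4, b 5] i ∈ Submodule.span K (Set.range ![b 3, b 4, b 5]) :=
    fun i => Submodule.subset_span ⟨i, rfl⟩
  have m3 : ∀ i, ![b 0 + b 3, b 1 + b 4, b 6] i ∈
      Submodule.span K (Set.range ![b 0 + b 3, b 1 + b 4, b 6]) :=
    fun i => Submodule.subset_span ⟨i, rfl⟩
  refine ⟨_, _, _, f1, f2, f3, ?_⟩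
  generalize Submodule.span K (Set.range ![b 0, b 1, b 2]) = H1 at *
  generalize Submodule.span K (Set.range ![b 3, b 4, b 5]) = H2 at *
  generalize Submodule.span K (Set.range ![b 0 + b 3, b 1 + b 4, b 6]) = H3 at *
  have key : Q K 4 H1 ⊓ Q K 4 H2 ⊓ Q K 4 H3 =
      Submodule.span K {ι K (b 0) * (ι K (b 1) * (ι K (b 3) * ι K (b 4)))} := by
    apply le_antisymm
    · rintro z ⟨⟨z1, z2⟩, z3⟩
      rw [Submodule.mem_span_singleton]
      obtain ⟨c, hc⟩ := main b z (Q_deg H1 z z1)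
        (by
          intro s t hs ht
          refine Q_zero H1 f1 _ _ ?_ ?_ z z1
          · rcases hs with rfl | rfl | rfl
            exacts [m1 0, m1 1, m1 2]
          · rcases ht with rfl | rfl | rfl
            exacts [m1 0, m1 1, m1 2])
        (by
          intro s t hs ht
          refine Q_zero H2 f2 _ _ ?_ ?_ z z2
          · rcases hs with rfl | rfl | rfl
            exacts [m2 0, m2 1, m2 2]
          · rcases ht with rfl | rfl | rfl
            exacts [m2 0, m2 1, m2 2])
        (Q_zero H3 f3 _ _ (m3 2) (m3 0) z z3)
        (Q_zero H3 f3 _ _ (m3 2) (m3 1) z z3)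
      exact ⟨c, hc.symm⟩
    · rw [Submodule.span_singleton_le_iff_mem]
      refine ⟨⟨?_, ?_⟩, ?_⟩
      · refine Submodule.subset_span ⟨b 0, m1 0, b 1, m1 1, _, mem2 (b 3) (b 4), ?_⟩
        rw [mul_assoc]
      · refine Submodule.subset_span ⟨b 3, m2 0, b 4, m2 1, _, mem2 (b 0) (b 1), ?_⟩
        rw [mul_assoc, anti (b 4) (b 0), mul_neg, anti (b 3) (b 0)]
        have h41 : ι K (b 4) * ι K (b 1) = - (ι K (b 1) * ι K (b 4)) :=
          eq_neg_of_add_eq_zero_left (ι_add_mul_swap _ _)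
        rw [h41, mul_neg, anti (b 3) (b 1)]
        simp
      · refine Submodule.subset_span ⟨b 0 + b 3, m3 0, b 1 + b 4, m3 1, _, mem2 (b 3) (b 4), ?_⟩
        have h44 : ι K (b 4) * ι K (b 4) = 0 := ι_sq_zero _
        have h434 : ι K (b 4) * (ι K (b 3) * ι K (b 4)) = 0 := by
          rw [anti, h44]
          simp
        have h313 : ι K (b 3) * (ι K (b 1) * (ι K (b 3) * ι K (b 4))) = 0 := by
          rw [anti (b 3) (b 1), sq0]
          simp
        rw [mul_assoc, map_add, map_add, add_mul (ι K (b 1)), h434, add_zero, add_mul, h313, add_zero]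
  rw [key]
  exact finrank_span_singleton (w_ne b)
end

section
/- Let V be an 8-dimensional vector space over an algebraically closed field K of characteristic zero. For every three 4-dimensional linear subspaces H_1, H_2, H_3 of V, the intersection Q_4(H_1) ∩ Q_4(H_2) ∩ Q_4(H_3) inside ⋀^4 V has dimension at least 20. -/
open ExteriorAlgebra

namespace SecDef

open Module

variable {K V : Type*} [Field K] [AddCommGroup V] [Module K V]

/-- Image of a subspace in degree one. -/
abbrev J (H : Submodule K V) : Submodule K (ExteriorAlgebra K V) := H.map (ι K)

/-- The affine cone over the tangent space: `⋀³H ∧ V`. -/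
abbrev T (H : Submodule K V) : Submodule K (ExteriorAlgebra K V) := J H ^ 3 * J ⊤

theorem fin_ext [FiniteDimensional K V] : FiniteDimensional K (ExteriorAlgebra K V) :=
  Module.Finite.of_basis (Module.finBasis K V).ExteriorAlgebra

theorem ext_eq (n : ℕ) : (⋀[K]^n V) = J (⊤ : Submodule K V) ^ n := by
  rw [J, Submodule.map_top]

theorem iota_mem {n : ℕ} (H : Submodule K V) (v : Fin n → V) (hv : ∀ i, v i ∈ H) :
    ιMulti K n v ∈ J H ^ n := by
  induction n with
  | zero => simp
  | succ n ih =>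
    rw [ιMulti_succ_apply, pow_succ']
    exact Submodule.mul_mem_mul (Submodule.mem_map_of_mem (hv 0)) (ih _ fun i => hv _)

theorem iota_ne_zero {n : ℕ} (v : Fin n → V) (hv : LinearIndependent K v) :
    ιMulti K n v ≠ 0 := by
  have h := (exteriorPower.ιMulti_family_linearIndependent_field n hv).ne_zero
    (Set.powersetCard.ofFinEmbEquiv (RelEmbedding.refl _))
  intro h0
  apply h
  ext
  change ExteriorAlgebra.ιMulti K n (v ∘ (Set.powersetCard.ofFinEmbEquiv.symm
    (Set.powersetCard.ofFinEmbEquiv _))) = 0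
  rw [Equiv.symm_apply_apply]
  exact h0

theorem prod4_ne_zero (v : Fin 4 → V) (hv : LinearIndependent K v) :
    ι K (v 0) * ι K (v 1) * ι K (v 2) * ι K (v 3) ≠ 0 := by
  have := iota_ne_zero v hv
  rw [ιMulti_apply] at this
  simpa [List.ofFn_succ, mul_assoc] using this

theorem finrank_pow_le [FiniteDimensional K V] (A : Submodule K V) (n : ℕ) :
    finrank K ↥(J A ^ n) ≤ (finrank K A).choose n := by
  have : J A ^ n = (⋀[K]^n A).map (ExteriorAlgebra.map A.subtype).toLinearMap := by
    rw [exteriorPower, Submodule.map_pow, ι_range_map_map, Submodule.range_subtype]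
  rw [this, ← exteriorPower.finrank_eq]
  exact Submodule.finrank_map_le _ _

theorem finrank_mul_le [FiniteDimensional K V] (M N : Submodule K (ExteriorAlgebra K V)) :
    finrank K ↥(M * N) ≤ finrank K M * finrank K N := by
  have := fin_ext (K := K) (V := V)
  rw [← Submodule.mulMap_range, ← finrank_tensorProduct]
  exact LinearMap.finrank_range_le _

theorem J_comm (A B : Submodule K V) : J A * J B = J B * J A := by
  have key : ∀ A B : Submodule K V, J A * J B ≤ J B * J A := by
    intro A B
    rw [Submodule.mul_le]
    rintro _ ⟨a, ha, rfl⟩ _ ⟨b, hb, rfl⟩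
    rw [eq_neg_of_add_eq_zero_left (ι_add_mul_swap a b)]
    exact neg_mem (Submodule.mul_mem_mul (Submodule.mem_map_of_mem hb)
      (Submodule.mem_map_of_mem ha))
  exact le_antisymm (key A B) (key B A)

theorem basis_mul {I : Type*} [LinearOrder I] (b : Basis I K V) (s t : Finset I)
    (h : Disjoint s t) : b.ExteriorAlgebra s * b.ExteriorAlgebra t = b.ExteriorAlgebra (s ∪ t) ∨
      b.ExteriorAlgebra s * b.ExteriorAlgebra t = - b.ExteriorAlgebra (s ∪ t) := by
  have := basis_mul_of_disjoint b (Set.powersetCard.ofCard (s := s) rfl)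
    (Set.powersetCard.ofCard (s := t) rfl) h
  have hu : (Set.powersetCard.disjUnion (s := Set.powersetCard.ofCard (s := s) rfl)
    (t := Set.powersetCard.ofCard (s := t) rfl) h : Finset I) = s ∪ t :=
    Finset.disjUnion_eq_union _ _ h
  simp only [Set.powersetCard.val_ofCard] at this
  rw [this, hu]
  rcases Int.units_eq_one_or (Equiv.Perm.sign (Set.powersetCard.permOfDisjoint
    (s := Set.powersetCard.ofCard (s := s) rfl) (t := Set.powersetCard.ofCard (s := t) rfl) h))
    with h1 | h1 <;> rw [h1] <;> simp

theorem basis_mul_zero {I : Type*} [LinearOrder I] (b : Basis I K V) (s t : Finset I)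
    (h : ¬ Disjoint s t) : b.ExteriorAlgebra s * b.ExteriorAlgebra t = 0 :=
  basis_mul_of_not_disjoint b (Set.powersetCard.ofCard (s := s) rfl)
    (Set.powersetCard.ofCard (s := t) rfl) h

theorem basis_mem {I : Type*} [LinearOrder I] (b : Basis I K V) (s : Finset I) (n : ℕ)
    (hn : s.card = n) (H : Submodule K V) (hs : ∀ i ∈ s, b i ∈ H) :
    b.ExteriorAlgebra s ∈ J H ^ n := by
  rw [basis_apply_ofCard b hn]
  apply iota_mem
  intro i
  apply hs
  exact (Set.powersetCard.mem_range_ofFinEmbEquiv_symm_iff_mem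
    (Set.powersetCard.ofCard hn) _).1 ⟨i, rfl⟩

/-- basis elements with enough indices in `H` lie in `⋀^p H ∧ ⋀^q V`. -/
theorem basis_mem_mul {I : Type*} [LinearOrder I] (b : Basis I K V) (s : Finset I) (L : Finset I)
    (p q : ℕ) (hs : s.card = p + q) (hp : p ≤ (s ∩ L).card) (H : Submodule K V)
    (hH : ∀ i ∈ L, b i ∈ H) : b.ExteriorAlgebra s ∈ J H ^ p * J ⊤ ^ q := by
  obtain ⟨s1, h1, h1c⟩ := Finset.exists_subset_card_eq hp
  have h1s : s1 ⊆ s := h1.trans Finset.inter_subset_left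
  have hm := Submodule.mul_mem_mul
    (basis_mem b s1 p h1c H fun i hi => hH i (Finset.mem_inter.1 (h1 hi)).2)
    (basis_mem b (s \ s1) q (by rw [Finset.card_sdiff_of_subset h1s]; omega) ⊤ fun i _ => trivial)
  rcases basis_mul b s1 (s \ s1) Finset.disjoint_sdiff with h | h <;>
    rw [h, Finset.union_sdiff_of_subset h1s] at hm
  · exact hm
  · simpa using hm

theorem le_Q (H : Submodule K V) : J H ^ 2 * J ⊤ ^ 2 ≤ Q K 4 H := by
  rw [Submodule.mul_le, pow_two (J H), ← ext_eq]
  intro m hm n hn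
  induction hm using Submodule.mul_induction_on' with
  | mem_mul_mem x hx y hy =>
    obtain ⟨x, hx, rfl⟩ := hx
    obtain ⟨y, hy, rfl⟩ := hy
    exact Submodule.subset_span ⟨x, hx, y, hy, n, hn, rfl⟩
  | add x _ y _ h1 h2 => rw [add_mul]; exact add_mem h1 h2

theorem exists_basis [FiniteDimensional K V] (hV : finrank K V = 8) (H : Submodule K V)
    (hH : finrank K H = 4) : ∃ b : Basis (Fin 8) K V, ∀ i : Fin 8, i.val < 4 → b i ∈ H := by
  obtain ⟨C, hC⟩ := H.exists_isCompl
  have hC4 : finrank K C = 4 := by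
    have := Submodule.finrank_add_eq_of_isCompl hC
    omega
  let b0 := ((Module.finBasisOfFinrankEq K H hH).prod (Module.finBasisOfFinrankEq K C hC4)).map
    (Submodule.prodEquivOfIsCompl H C hC)
  refine ⟨b0.reindex finSumFinEquiv, fun i hi => ?_⟩
  have : i = (finSumFinEquiv (Sum.inl (⟨i.val, hi⟩ : Fin 4) : Fin 4 ⊕ Fin 4) : Fin 8) := by
    rfl
  rw [this, Basis.reindex_apply, Equiv.symm_apply_apply]
  simp [b0]

theorem ortho [FiniteDimensional K V] (hV : finrank K V = 8) (H : Submodule K V)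
    (hH : finrank K H = 4) (w : ExteriorAlgebra K V) (hw : w ∈ ⋀[K]^4 V)
    (h : ∀ t ∈ T H, w * t = 0) : w ∈ Q K 4 H := by
  obtain ⟨b, hb⟩ := exists_basis hV H hH
  have hL : ∀ i ∈ (Finset.univ.filter fun i : Fin 8 => i.val < 4), b i ∈ H := fun i hi =>
    hb i (by simpa using hi)
  set L := (Finset.univ.filter fun i : Fin 8 => i.val < 4) with hLdef
  set c := (b.exteriorPower 4).repr ⟨w, hw⟩ with hc
  have hsum : w = ∑ s : Set.powersetCard (Fin 8) 4, c s • b.ExteriorAlgebra s := by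
    have := congrArg Subtype.val ((b.exteriorPower 4).sum_repr ⟨w, hw⟩)
    simp only [Submodule.coe_sum, Submodule.coe_smul] at this
    simp only [basis_eq_coe_basis]
    exact this.symm
  rw [hsum]
  refine Submodule.sum_mem _ fun s _ => ?_
  have hs4 : (s : Finset (Fin 8)).card = 4 := s.2
  by_cases h2 : 2 ≤ ((s : Finset (Fin 8)) ∩ L).card
  · exact Submodule.smul_mem _ _ (le_Q H (basis_mem_mul b s L 2 2 hs4 h2 H hL))
  · suffices c s = 0 by rw [this]; simp
    have h3 : 3 ≤ ((s : Finset (Fin 8))ᶜ ∩ L).card := by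
      have : L.card = 4 := by rw [hLdef]; decide
      have h4 := Finset.card_inter_add_card_sdiff L (s : Finset (Fin 8))
      rw [Finset.inter_comm, Finset.sdiff_eq_inter_compl, Finset.inter_comm L] at h4
      omega
    have hm := basis_mem_mul b (s : Finset (Fin 8))ᶜ L 3 1
      (by rw [Finset.card_compl, hs4]; rfl) h3 H hL
    rw [pow_one] at hm
    have h0 := h _ hm
    rw [hsum, Finset.sum_mul, Finset.sum_eq_single s] at h0
    · have hne : b.ExteriorAlgebra s * b.ExteriorAlgebra (s : Finset (Fin 8))ᶜ ≠ 0 := by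
        rcases basis_mul b s (s : Finset (Fin 8))ᶜ disjoint_compl_right with h | h <;> rw [h]
        · exact b.ExteriorAlgebra.ne_zero _
        · exact neg_ne_zero.2 (b.ExteriorAlgebra.ne_zero _)
      rw [smul_mul_assoc] at h0
      exact (smul_eq_zero.1 h0).resolve_right hne
    · intro s' _ hne
      rw [smul_mul_assoc, basis_mul_zero, smul_zero]
      intro hd
      rw [disjoint_compl_right_iff] at hd
      exact hne (Subtype.ext (Finset.eq_of_subset_of_card_le hd (by rw [hs4]; exact s'.2.ge)))
    · simp

theorem final [FiniteDimensional K V] (hV : finrank K V = 8) (H₁ H₂ H₃ : Submodule K V)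
    (hH₁ : finrank K H₁ = 4) (hH₂ : finrank K H₂ = 4) (hH₃ : finrank K H₃ = 4)
    (h : finrank K ↥(T H₁ ⊔ T H₂ ⊔ T H₃) ≤ 50) :
    20 ≤ finrank K ↥(Q K 4 H₁ ⊓ Q K 4 H₂ ⊓ Q K 4 H₃) := by
  have := fin_ext (K := K) (V := V)
  set S := T H₁ ⊔ T H₂ ⊔ T H₃ with hS
  have hT : ∀ H : Submodule K V, T H ≤ ⋀[K]^4 V := by
    intro H
    rw [ext_eq, pow_succ]
    exact mul_le_mul' (pow_le_pow_left' (Submodule.map_mono le_top) 3) le_rfl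
  have hS4 : S ≤ ⋀[K]^4 V := sup_le (sup_le (hT _) (hT _)) (hT _)
  have hmul : ∀ (a : ⋀[K]^4 V) (s : S), (a : ExteriorAlgebra K V) * s ∈ ⋀[K]^8 V := by
    intro a s
    rw [exteriorPower, show 8 = 4 + 4 from rfl, pow_add]
    exact Submodule.mul_mem_mul a.2 (hS4 s.2)
  let f : (⋀[K]^4 V) →ₗ[K] S →ₗ[K] (⋀[K]^8 V) := LinearMap.mk₂ K
    (fun a s => ⟨(a : ExteriorAlgebra K V) * s, hmul a s⟩)
    (fun a b s => by ext; simp [add_mul]) (fun c a s => by ext; simp)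
    (fun a s t => by ext; simp [mul_add]) (fun c a s => by ext; simp)
  have h1 := LinearMap.finrank_range_add_finrank_ker (K := K) (V := ⋀[K]^4 V) (V₂ := S →ₗ[K] (⋀[K]^8 V)) f
  have h2 : finrank K (LinearMap.range f) ≤ 50 := by
    refine (Submodule.finrank_le _).trans ?_
    rw [finrank_linearMap, exteriorPower.finrank_eq, hV]
    simpa using h
  rw [exteriorPower.finrank_eq, hV] at h1
  have h3 : (LinearMap.ker f).map (Submodule.subtype _) ≤ Q K 4 H₁ ⊓ Q K 4 H₂ ⊓ Q K 4 H₃ := by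
    rintro _ ⟨w, hw, rfl⟩
    have hw0 : ∀ t ∈ S, (w : ExteriorAlgebra K V) * t = 0 := by
      intro t ht
      have := LinearMap.congr_fun (LinearMap.mem_ker.1 hw) ⟨t, ht⟩
      simpa [f] using congrArg Subtype.val this
    refine ⟨⟨ortho hV _ hH₁ _ w.2 fun t ht => hw0 t ?_, ortho hV _ hH₂ _ w.2 fun t ht => hw0 t ?_⟩,
      ortho hV _ hH₃ _ w.2 fun t ht => hw0 t ?_⟩
    · exact Submodule.mem_sup_left (Submodule.mem_sup_left ht)
    · exact Submodule.mem_sup_left (Submodule.mem_sup_right ht)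
    · exact Submodule.mem_sup_right ht
  have h4 := Submodule.finrank_mono h3
  rw [Submodule.finrank_map_subtype_eq] at h4
  have : Nat.choose 8 4 = 70 := rfl
  omega

theorem mem_T4 {H : Submodule K V} {x y z v : V} (hx : x ∈ H) (hy : y ∈ H) (hz : z ∈ H) :
    ι K x * ι K y * ι K z * ι K v ∈ T H := by
  rw [T, pow_succ, pow_two]
  exact Submodule.mul_mem_mul (Submodule.mul_mem_mul (Submodule.mul_mem_mul
    (Submodule.mem_map_of_mem hx) (Submodule.mem_map_of_mem hy)) (Submodule.mem_map_of_mem hz))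
    (Submodule.mem_map_of_mem trivial)

theorem swap (x y : V) : ι K x * ι K y = - (ι K y * ι K x) :=
  eq_neg_of_add_eq_zero_left (ι_add_mul_swap x y)

theorem mem_T3 {H : Submodule K V} {x y z v : V} (hx : x ∈ H) (hy : y ∈ H) (hz : z ∈ H) :
    ι K x * ι K y * ι K v * ι K z ∈ T H := by
  rw [mul_assoc (ι K x * ι K y), swap v z, mul_neg, ← mul_assoc]
  exact neg_mem (mem_T4 hx hy hz)

theorem mem_T2 {H : Submodule K V} {x y z v : V} (hx : x ∈ H) (hy : y ∈ H) (hz : z ∈ H) :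
    ι K x * ι K v * ι K y * ι K z ∈ T H := by
  rw [mul_assoc (ι K x), swap v y, mul_neg, ← mul_assoc, neg_mul]
  exact neg_mem (mem_T3 hx hy hz)

theorem mem_T1 {H : Submodule K V} {x y z v : V} (hx : x ∈ H) (hy : y ∈ H) (hz : z ∈ H) :
    ι K v * ι K x * ι K y * ι K z ∈ T H := by
  rw [swap v x, neg_mul, neg_mul]
  exact neg_mem (mem_T2 hx hy hz)

theorem sup_le_add [FiniteDimensional K V] (M N : Submodule K (ExteriorAlgebra K V)) {m n : ℕ}
    (hm : finrank K M ≤ m) (hn : finrank K N ≤ n) : finrank K ↥(M ⊔ N) ≤ m + n := by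
  have := fin_ext (K := K) (V := V)
  exact (Submodule.finrank_add_le_finrank_add_finrank M N).trans (add_le_add hm hn)

theorem J_sup (A B : Submodule K V) : J (A ⊔ B) = J A ⊔ J B := Submodule.map_sup _ _ _

theorem T_le [FiniteDimensional K V] (hV : finrank K V = 8) (H : Submodule K V)
    (hH : finrank K H = 4) : finrank K (T H) ≤ 17 := by
  obtain ⟨C, hC⟩ := H.exists_isCompl
  have hC4 : finrank K C = 4 := by
    have := Submodule.finrank_add_eq_of_isCompl hC
    omega
  have h : T H = J H ^ 4 ⊔ J H ^ 3 * J C := by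
    rw [T, ← hC.sup_eq_top, J_sup, Submodule.mul_sup, ← pow_succ]
  rw [h]
  refine sup_le_add _ _ (m := 1) (n := 16) ?_ ?_
  · exact (finrank_pow_le H 4).trans (by rw [hH]; decide)
  · refine (finrank_mul_le _ _).trans ?_
    have h1 := finrank_pow_le H 3
    have h2 : finrank K (J C) ≤ 4 := hC4 ▸ Submodule.finrank_map_le _ _
    rw [hH] at h1
    exact Nat.mul_le_mul h1 h2

theorem of_rel [FiniteDimensional K V] (hV : finrank K V = 8) (H₁ H₂ H₃ : Submodule K V)
    (hH₁ : finrank K H₁ = 4) (hH₂ : finrank K H₂ = 4) (hH₃ : finrank K H₃ = 4)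
    (t : ExteriorAlgebra K V) (h0 : t ≠ 0) (h3 : t ∈ T H₃) (h12 : t ∈ T H₁ ⊔ T H₂) :
    finrank K ↥(T H₁ ⊔ T H₂ ⊔ T H₃) ≤ 50 := by
  have := fin_ext (K := K) (V := V)
  have h1 := sup_le_add _ _ (T_le hV H₁ hH₁) (T_le hV H₂ hH₂)
  have h2 := T_le hV H₃ hH₃
  have h4 := Submodule.finrank_sup_add_finrank_inf_eq (T H₁ ⊔ T H₂) (T H₃)
  have h5 : 0 < finrank K ↥((T H₁ ⊔ T H₂) ⊓ T H₃) := by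
    rw [Nat.pos_iff_ne_zero, Ne, Submodule.finrank_eq_zero]
    intro hb
    exact h0 ((Submodule.eq_bot_iff _).1 hb t ⟨h12, h3⟩)
  omega

theorem exists_new [FiniteDimensional K V] (W : Submodule K V) {n : ℕ} (s : Fin n → V)
    (h : n < finrank K W) : ∃ y ∈ W, y ∉ Submodule.span K (Set.range s) := by
  by_contra! hc
  have h1 := Submodule.finrank_mono (show W ≤ Submodule.span K (Set.range s) from hc)
  have h2 := finrank_range_le_card (R := K) s
  simp [Set.finrank] at h2
  omega

theorem span_le' {W : Submodule K V} {n : ℕ} (s : Fin n → V) (h : ∀ i, s i ∈ W) {y : V}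
    (hy : y ∉ W) : y ∉ Submodule.span K (Set.range s) := fun h' =>
  hy (Submodule.span_le.2 (by rintro _ ⟨i, rfl⟩; exact h i) h')

theorem case_inter [FiniteDimensional K V] (hV : finrank K V = 8) (H₁ H₂ H₃ : Submodule K V)
    (hH₁ : finrank K H₁ = 4) (hH₂ : finrank K H₂ = 4) (hH₃ : finrank K H₃ = 4)
    (x : V) (hx1 : x ∈ H₁) (hx2 : x ∈ H₂) (hx3 : x ∉ H₃) :
    finrank K ↥(T H₁ ⊔ T H₂ ⊔ T H₃) ≤ 50 := by
  have h0 : LinearIndependent K (![] : Fin 0 → V) := linearIndependent_empty_type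
  by_cases h2 : 2 ≤ finrank K ↥(H₁ ⊓ H₂)
  · rw [sup_assoc, sup_comm, sup_comm (T H₂)]
    by_cases he : H₁ = H₂
    · rw [he, sup_assoc, sup_idem]
      exact (sup_le_add _ _ (T_le hV H₃ hH₃) (T_le hV H₂ hH₂)).trans (by norm_num)
    · obtain ⟨a, ha1, ha2⟩ : ∃ a ∈ H₁, a ∉ H₂ := by
        by_contra! hc
        exact he (Submodule.eq_of_le_of_finrank_eq hc (by rw [hH₁, hH₂]))
      obtain ⟨p, ⟨hp1, hp2⟩, hp⟩ := exists_new (H₁ ⊓ H₂) ![] (by omega)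
      have i1 := h0.finCons hp
      obtain ⟨q, ⟨hq1, hq2⟩, hq⟩ := exists_new (H₁ ⊓ H₂) _ (by omega : 1 < _)
      have i2 := i1.finCons hq
      obtain ⟨b, hb1, hb⟩ := exists_new H₂ _ (by omega : 2 < _)
      have i3 := i2.finCons hb
      have i4 := i3.finCons (x := a) (span_le' (W := H₂) _ (by
        intro i; fin_cases i <;> simpa) ha2)
      have hne := prod4_ne_zero _ i4
      refine of_rel hV H₃ H₂ H₁ hH₃ hH₂ hH₁ _ hne ?_ (Submodule.mem_sup_right ?_)
      · exact mem_T2 ha1 hq1 hp1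
      · exact mem_T1 hb1 hq2 hp2
  · have hs := Submodule.finrank_sup_add_finrank_inf_eq H₁ H₂
    have hs' := Submodule.finrank_sup_add_finrank_inf_eq H₃ (H₁ ⊔ H₂)
    have hle := Submodule.finrank_le (H₃ ⊔ (H₁ ⊔ H₂))
    have h3 : 3 ≤ finrank K ↥(H₃ ⊓ (H₁ ⊔ H₂)) := by omega
    obtain ⟨p, ⟨hp1, hp2⟩, hp⟩ := exists_new (H₃ ⊓ (H₁ ⊔ H₂)) ![] (by omega)
    have i1 := h0.finCons hp
    obtain ⟨q, ⟨hq1, hq2⟩, hq⟩ := exists_new (H₃ ⊓ (H₁ ⊔ H₂)) _ (by omega : 1 < _)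
    have i2 := i1.finCons hq
    obtain ⟨r, ⟨hr1, hr2⟩, hr⟩ := exists_new (H₃ ⊓ (H₁ ⊔ H₂)) _ (by omega : 2 < _)
    have i3 := i2.finCons hr
    have i4 := i3.finCons (x := x) (span_le' (W := H₃) _ (by
        intro i; fin_cases i <;> simpa) hx3)
    have hne := prod4_ne_zero _ i4
    refine of_rel hV H₁ H₂ H₃ hH₁ hH₂ hH₃ _ hne (mem_T1 hr1 hq1 hp1) ?_
    change ι K x * ι K r * ι K q * ι K p ∈ _
    obtain ⟨a1, ha1, b1, hb1, rfl⟩ := Submodule.mem_sup.1 hp2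
    obtain ⟨a2, ha2, b2, hb2, rfl⟩ := Submodule.mem_sup.1 hq2
    obtain ⟨a3, ha3, b3, hb3, rfl⟩ := Submodule.mem_sup.1 hr2
    have e : ι K x * ι K (a3 + b3) * ι K (a2 + b2) * ι K (a1 + b1) =
      (ι K x * ι K a3 * ι K a2 * ι K a1 + ι K x * ι K a3 * ι K a2 * ι K b1
        + ι K x * ι K a3 * ι K b2 * ι K a1 + ι K x * ι K b3 * ι K a2 * ι K a1)
      + (ι K x * ι K b3 * ι K b2 * ι K b1 + ι K x * ι K b3 * ι K b2 * ι K a1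
        + ι K x * ι K b3 * ι K a2 * ι K b1 + ι K x * ι K a3 * ι K b2 * ι K b1) := by
      simp only [map_add, mul_add, add_mul]; abel
    rw [e]
    refine Submodule.add_mem_sup ?_ ?_
    · exact add_mem (add_mem (add_mem (mem_T4 hx1 ha3 ha2) (mem_T4 hx1 ha3 ha2))
        (mem_T3 hx1 ha3 ha1)) (mem_T2 hx1 ha2 ha1)
    · exact add_mem (add_mem (add_mem (mem_T4 hx2 hb3 hb2) (mem_T4 hx2 hb3 hb2))
        (mem_T3 hx2 hb3 hb1)) (mem_T2 hx2 hb2 hb1)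

theorem case_gen [FiniteDimensional K V] [CharZero K] (hV : finrank K V = 8)
    (H₁ H₂ H₃ : Submodule K V)
    (hH₁ : finrank K H₁ = 4) (hH₂ : finrank K H₂ = 4) (hH₃ : finrank K H₃ = 4)
    (h12 : H₁ ⊓ H₂ = ⊥) (h23 : H₂ ⊓ H₃ = ⊥) :
    finrank K ↥(T H₁ ⊔ T H₂ ⊔ T H₃) ≤ 50 := by
  have hc : IsCompl H₁ H₂ := by
    refine ⟨disjoint_iff.2 h12, codisjoint_iff.2 ?_⟩
    apply Submodule.eq_top_of_finrank_eq
    have := Submodule.finrank_sup_add_finrank_inf_eq H₁ H₂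
    rw [h12, finrank_bot] at this
    omega
  let f := Submodule.projectionOnto H₁ H₂ hc
  let c0 := Module.finBasisOfFinrankEq K H₃ hH₃
  let c : Fin 4 → V := fun i => c0 i
  have hcH : ∀ i, c i ∈ H₃ := fun i => (c0 i).2
  have hci : LinearIndependent K c := c0.linearIndependent.map' H₃.subtype H₃.ker_subtype
  have hfc : LinearIndependent K (f ∘ c) := by
    apply hci.map
    rw [show f.ker = H₂ from Submodule.ker_projectionOnto _]
    refine Disjoint.mono_left ?_ (disjoint_iff.2 (by rw [inf_comm]; exact h23) : Disjoint H₃ H₂)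
    exact Submodule.span_le.2 (by rintro _ ⟨i, rfl⟩; exact hcH i)
  obtain ⟨a, ha, b, hb, hab, hfa, hfb⟩ : ∃ a : Fin 4 → V, (∀ i, a i ∈ H₁) ∧ ∃ b : Fin 4 → V,
      (∀ i, b i ∈ H₂) ∧ (∀ i, c i = a i + b i) ∧ (∀ i, f (a i) = f (c i)) ∧
      (∀ i, f (b i) = 0) := by
    have key : ∀ i, ∃ a ∈ H₁, ∃ b ∈ H₂, a + b = c i := fun i =>
      Submodule.mem_sup.1 (hc.sup_eq_top ▸ Submodule.mem_top)
    choose a ha b hb hab using key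
    have hfb : ∀ i, f (b i) = 0 := fun i =>
      (Submodule.projectionOnto_apply_eq_zero_iff hc).2 (hb i)
    exact ⟨a, ha, b, hb, fun i => (hab i).symm, fun i => by rw [← hab i, map_add, hfb, add_zero],
      hfb⟩
  have hne := prod4_ne_zero _ hfc
  let t : ExteriorAlgebra K V :=
    ι K (a 0 - b 0) * ι K (c 1) * ι K (c 2) * ι K (c 3) +
    ι K (c 0) * ι K (a 1 - b 1) * ι K (c 2) * ι K (c 3) +
    ι K (c 0) * ι K (c 1) * ι K (a 2 - b 2) * ι K (c 3) +
    ι K (c 0) * ι K (c 1) * ι K (c 2) * ι K (a 3 - b 3)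
  refine of_rel hV H₁ H₂ H₃ hH₁ hH₂ hH₃ t ?_ ?_ ?_
  · intro ht
    have h1 := congrArg (ExteriorAlgebra.map f) ht
    simp only [t, map_add, map_mul, map_apply_ι, map_sub, hfa, hfb, map_zero, sub_zero] at h1
    set P := ι K (f (c 0)) * ι K (f (c 1)) * ι K (f (c 2)) * ι K (f (c 3)) with hP
    have h2 : (4 : K) • P = 0 := by
      rw [← h1]; module
    rcases smul_eq_zero.1 h2 with h | h
    · norm_num at h
    · exact hne h
  · exact add_mem (add_mem (add_mem (mem_T1 (hcH _) (hcH _) (hcH _))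
      (mem_T2 (hcH _) (hcH _) (hcH _))) (mem_T3 (hcH _) (hcH _) (hcH _)))
      (mem_T4 (hcH _) (hcH _) (hcH _))
  · have e : t = ((4 : ℤ) • (ι K (a 0) * ι K (a 1) * ι K (a 2) * ι K (a 3))
        + (2 : ℤ) • (ι K (a 0) * ι K (a 1) * ι K (a 2) * ι K (b 3)
          + ι K (a 0) * ι K (a 1) * ι K (b 2) * ι K (a 3)
          + ι K (a 0) * ι K (b 1) * ι K (a 2) * ι K (a 3)
          + ι K (b 0) * ι K (a 1) * ι K (a 2) * ι K (a 3)))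
      + ((-4 : ℤ) • (ι K (b 0) * ι K (b 1) * ι K (b 2) * ι K (b 3))
        + (-2 : ℤ) • (ι K (b 0) * ι K (b 1) * ι K (b 2) * ι K (a 3)
          + ι K (b 0) * ι K (b 1) * ι K (a 2) * ι K (b 3)
          + ι K (b 0) * ι K (a 1) * ι K (b 2) * ι K (b 3)
          + ι K (a 0) * ι K (b 1) * ι K (b 2) * ι K (b 3))) := by
      simp only [t, hab, map_add, map_sub, mul_add, add_mul, mul_sub, sub_mul, smul_add]
      abel
    rw [e]
    refine Submodule.add_mem_sup ?_ ?_
    · exact add_mem (zsmul_mem (mem_T4 (ha _) (ha _) (ha _)) _) (zsmul_mem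
        (add_mem (add_mem (add_mem (mem_T4 (ha _) (ha _) (ha _)) (mem_T3 (ha _) (ha _) (ha _)))
          (mem_T2 (ha _) (ha _) (ha _))) (mem_T1 (ha _) (ha _) (ha _))) _)
    · exact add_mem (zsmul_mem (mem_T4 (hb _) (hb _) (hb _)) _) (zsmul_mem
        (add_mem (add_mem (add_mem (mem_T4 (hb _) (hb _) (hb _)) (mem_T3 (hb _) (hb _) (hb _)))
          (mem_T2 (hb _) (hb _) (hb _))) (mem_T1 (hb _) (hb _) (hb _))) _)

theorem pow_sup_le (P H : Submodule K V) (n : ℕ) :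
    (J P ⊔ J H) ^ (n + 1) ≤ J P * J ⊤ ^ n ⊔ J H ^ (n + 1) := by
  have hP : J P ≤ J ⊤ := Submodule.map_mono le_top
  have hH : J H ≤ J ⊤ := Submodule.map_mono le_top
  induction n with
  | zero => simp
  | succ n ih =>
    rw [pow_succ']
    refine (mul_le_mul' le_rfl ih).trans ?_
    rw [Submodule.sup_mul, Submodule.mul_sup, Submodule.mul_sup]
    refine sup_le (sup_le ?_ ?_) (sup_le ?_ ?_)
    · refine le_sup_of_le_left (mul_le_mul' le_rfl ?_)
      rw [pow_succ']
      exact mul_le_mul' hP le_rfl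
    · exact le_sup_of_le_left (mul_le_mul' le_rfl (pow_le_pow_left' hH _))
    · refine le_sup_of_le_left ?_
      rw [← mul_assoc, J_comm, mul_assoc, pow_succ']
      exact mul_le_mul' le_rfl (mul_le_mul' hH le_rfl)
    · rw [← pow_succ']
      exact le_sup_right

theorem common_one [FiniteDimensional K V] (hV : finrank K V = 8) (H : Submodule K V)
    (hH : finrank K H = 4) (x : V) (hx : x ≠ 0) (hxH : x ∈ H) :
    ∃ R : Submodule K (ExteriorAlgebra K V), finrank K R ≤ 4 ∧
      T H ≤ J (K ∙ x) * J ⊤ ^ 3 ⊔ R := by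
  obtain ⟨C, hC⟩ := H.exists_isCompl
  have hC4 : finrank K C = 4 := by
    have := Submodule.finrank_add_eq_of_isCompl hC
    omega
  have hPH : (K ∙ x) ≤ H := by simpa using hxH
  obtain ⟨D, hD⟩ := (K ∙ x).exists_isCompl
  have hs : (K ∙ x) ⊔ (D ⊓ H) = H := by
    rw [← sup_inf_assoc_of_le D hPH, hD.sup_eq_top, top_inf_eq]
  have hi : (K ∙ x) ⊓ (D ⊓ H) = ⊥ := by
    rw [← inf_assoc, hD.inf_eq_bot, bot_inf_eq]
  have h3 : finrank K ↥(D ⊓ H) = 3 := by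
    have := Submodule.finrank_sup_add_finrank_inf_eq (K ∙ x) (D ⊓ H)
    rw [hs, hi, finrank_bot, finrank_span_singleton hx, hH] at this
    omega
  generalize D ⊓ H = H' at hs h3
  have hHt : J H' ≤ J ⊤ := Submodule.map_mono le_top
  refine ⟨J H' ^ 3 * J C, ?_, ?_⟩
  · have h1 := finrank_pow_le H' 3
    have h2 : finrank K (J C) ≤ 4 := hC4 ▸ Submodule.finrank_map_le _ _
    rw [h3] at h1
    exact (finrank_mul_le _ _).trans (Nat.mul_le_mul h1 h2)
  · have h4 : J H' ^ 4 = ⊥ := by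
      have := fin_ext (K := K) (V := V)
      have h1 := finrank_pow_le H' 4
      rw [h3] at h1
      exact Submodule.finrank_eq_zero.1 (Nat.le_zero.1 h1)
    have e : T H ≤ (J (K ∙ x) * J ⊤ ^ 2 ⊔ J H' ^ 3) * J ⊤ := by
      refine mul_le_mul' ?_ le_rfl
      rw [← hs, J_sup]
      exact pow_sup_le _ _ 2
    refine e.trans ?_
    rw [Submodule.sup_mul, mul_assoc, ← pow_succ]
    refine sup_le le_sup_left ?_
    have ht : J (⊤ : Submodule K V) = J (K ∙ x) ⊔ J H' ⊔ J C := by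
      rw [← J_sup, ← J_sup, hs, hC.sup_eq_top]
    conv_lhs => rw [ht, Submodule.mul_sup, Submodule.mul_sup, ← pow_succ, h4]
    refine sup_le (sup_le ?_ bot_le) le_sup_right
    have hcm : J H' ^ 3 * J (K ∙ x) = J (K ∙ x) * J H' ^ 3 :=
      Commute.pow_left (J_comm H' (K ∙ x)) 3
    rw [hcm]
    exact le_sup_of_le_left (mul_le_mul' le_rfl (pow_le_pow_left' hHt _))

theorem common_X [FiniteDimensional K V] (hV : finrank K V = 8) (x : V) (hx : x ≠ 0) :
    finrank K ↥(J (K ∙ x) * J (⊤ : Submodule K V) ^ 3) ≤ 35 := by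
  have := fin_ext (K := K) (V := V)
  obtain ⟨D, hD⟩ := (K ∙ x).exists_isCompl
  have h7 : finrank K D = 7 := by
    have := Submodule.finrank_add_eq_of_isCompl hD
    rw [finrank_span_singleton hx] at this
    omega
  have h1 : finrank K (J (K ∙ x)) ≤ 1 :=
    (Submodule.finrank_map_le _ _).trans (finrank_span_singleton hx).le
  have hpp : J (K ∙ x) * J (K ∙ x) = ⊥ := by
    rw [J, Submodule.map_span, Set.image_singleton, Submodule.span_mul_span]
    simp
  have h : J (K ∙ x) * J (⊤ : Submodule K V) ^ 3 ≤ J (K ∙ x) * J D ^ 3 := by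
    have e := pow_sup_le (K ∙ x) D 2
    rw [← J_sup, hD.sup_eq_top] at e
    refine (mul_le_mul' le_rfl e).trans ?_
    rw [Submodule.mul_sup, ← mul_assoc, hpp, Submodule.bot_mul, bot_sup_eq]
  refine (Submodule.finrank_mono h).trans ((finrank_mul_le _ _).trans ?_)
  have h2 := finrank_pow_le D 3
  rw [h7] at h2
  exact Nat.mul_le_mul h1 h2

theorem case_common [FiniteDimensional K V] (hV : finrank K V = 8) (H₁ H₂ H₃ : Submodule K V)
    (hH₁ : finrank K H₁ = 4) (hH₂ : finrank K H₂ = 4) (hH₃ : finrank K H₃ = 4)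
    (x : V) (hx : x ≠ 0) (hx1 : x ∈ H₁) (hx2 : x ∈ H₂) (hx3 : x ∈ H₃) :
    finrank K ↥(T H₁ ⊔ T H₂ ⊔ T H₃) ≤ 50 := by
  have := fin_ext (K := K) (V := V)
  obtain ⟨R1, r1, l1⟩ := common_one hV H₁ hH₁ x hx hx1
  obtain ⟨R2, r2, l2⟩ := common_one hV H₂ hH₂ x hx hx2
  obtain ⟨R3, r3, l3⟩ := common_one hV H₃ hH₃ x hx hx3
  have hX := common_X hV x hx
  set X := J (K ∙ x) * J (⊤ : Submodule K V) ^ 3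
  have h : T H₁ ⊔ T H₂ ⊔ T H₃ ≤ X ⊔ R1 ⊔ R2 ⊔ R3 := by
    refine sup_le (sup_le (l1.trans ?_) (l2.trans ?_)) (l3.trans ?_)
    · exact le_sup_of_le_left le_sup_left
    · exact le_sup_of_le_left (sup_le_sup_right le_sup_left _)
    · exact sup_le_sup_right (le_sup_of_le_left le_sup_left) _
  exact (Submodule.finrank_mono h).trans
    ((sup_le_add _ _ (sup_le_add _ _ (sup_le_add _ _ hX r1) r2) r3).trans (by norm_num))

theorem case_pair [FiniteDimensional K V] (hV : finrank K V = 8) (H₁ H₂ H₃ : Submodule K V)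
    (hH₁ : finrank K H₁ = 4) (hH₂ : finrank K H₂ = 4) (hH₃ : finrank K H₃ = 4)
    (h : H₁ ⊓ H₂ ≠ ⊥) : finrank K ↥(T H₁ ⊔ T H₂ ⊔ T H₃) ≤ 50 := by
  obtain ⟨x, ⟨hx1, hx2⟩, hx⟩ := Submodule.exists_mem_ne_zero_of_ne_bot h
  by_cases hx3 : x ∈ H₃
  · exact case_common hV _ _ _ hH₁ hH₂ hH₃ x hx hx1 hx2 hx3
  · exact case_inter hV _ _ _ hH₁ hH₂ hH₃ x hx1 hx2 hx3

theorem bound [FiniteDimensional K V] [CharZero K] (hV : finrank K V = 8)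
    (H₁ H₂ H₃ : Submodule K V)
    (hH₁ : finrank K H₁ = 4) (hH₂ : finrank K H₂ = 4) (hH₃ : finrank K H₃ = 4) :
    finrank K ↥(T H₁ ⊔ T H₂ ⊔ T H₃) ≤ 50 := by
  by_cases h12 : H₁ ⊓ H₂ = ⊥
  · by_cases h23 : H₂ ⊓ H₃ = ⊥
    · exact case_gen hV _ _ _ hH₁ hH₂ hH₃ h12 h23
    · rw [sup_assoc, sup_comm]
      exact case_pair hV _ _ _ hH₂ hH₃ hH₁ h23
  · exact case_pair hV _ _ _ hH₁ hH₂ hH₃ h12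

end SecDef

/-- For an 8-dimensional space `V` and any three 4-dimensional subspaces `H₁, H₂, H₃`,
the intersection `Q₄(H₁) ∩ Q₄(H₂) ∩ Q₄(H₃)` inside `⋀^4 V` has dimension at least 20. -/
theorem stmt13 {K V : Type*} [Field K] [CharZero K] [IsAlgClosed K]
    [AddCommGroup V] [Module K V] [FiniteDimensional K V]
    (hV : Module.finrank K V = 8)
    (H₁ H₂ H₃ : Submodule K V) (hH₁ : Module.finrank K H₁ = 4)
    (hH₂ : Module.finrank K H₂ = 4) (hH₃ : Module.finrank K H₃ = 4) :
    20 ≤ Module.finrank K ↥(Q K 4 H₁ ⊓ Q K 4 H₂ ⊓ Q K 4 H₃) := by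
  exact SecDef.final hV H₁ H₂ H₃ hH₁ hH₂ hH₃ (SecDef.bound hV H₁ H₂ H₃ hH₁ hH₂ hH₃)
end

section
/- Let V be a 9-dimensional vector space over an algebraically closed field K of characteristic zero. For every four 3-dimensional linear subspaces H_1, H_2, H_3, H_4 of V, the intersection Q_6(H_1) ∩ Q_6(H_2) ∩ Q_6(H_3) ∩ Q_6(H_4) inside ⋀^6 V has dimension at least 10. -/
open ExteriorAlgebra

lemma semicont {K W U : Type*} [Field K] [Infinite K] [AddCommGroup W] [Module K W]
    [FiniteDimensional K W] [AddCommGroup U] [Module K U] (A B C : W →ₗ[K] U) (n : ℕ)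
    (S : Set K) (hS : S.Finite)
    (h : ∀ t, t ∉ S → n ≤ Module.finrank K (LinearMap.ker (A + t • B + t ^ 2 • C))) :
    n ≤ Module.finrank K (LinearMap.ker A) := by
  classical
  by_contra hlt
  push Not at hlt
  obtain ⟨m, hm, v, hv⟩ : ∃ m, m = Module.finrank K (LinearMap.range A) ∧ ∃ v : Fin m → W,
      LinearIndependent K (fun j => A (v j)) := by
    let bb := Module.finBasis K (LinearMap.range A)
    have : ∀ j, ∃ w, A w = (bb j : U) := fun j => (bb j).2
    choose v hv using this
    refine ⟨_, rfl, v, ?_⟩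
    simp_rw [hv]
    exact bb.linearIndependent.map' (LinearMap.range A).subtype (Submodule.ker_subtype _)
  obtain ⟨g, hg⟩ : ∃ g : U →ₗ[K] (Fin m → K), g ∘ₗ (Fintype.linearCombination K (fun j => A (v j))) = LinearMap.id := by
    apply LinearMap.exists_leftInverse_of_injective
    rw [LinearMap.ker_eq_bot']
    intro c hc
    rw [Fintype.linearCombination_apply] at hc
    exact funext (Fintype.linearIndependent_iff.mp hv c hc)
  have hgA : ∀ j, g (A (v j)) = Pi.single j 1 := by
    intro j
    have := LinearMap.congr_fun hg (Pi.single j 1)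
    simpa [Fintype.linearCombination_apply_single] using this
  let M : Matrix (Fin m) (Fin m) (Polynomial K) := fun j i =>
    Polynomial.C (g (A (v j)) i) + Polynomial.X * Polynomial.C (g (B (v j)) i)
      + Polynomial.X ^ 2 * Polynomial.C (g (C (v j)) i)
  have hM : ∀ t, (M.det).eval t = Matrix.det (Matrix.of fun j i => g ((A + t • B + t ^ 2 • C) (v j)) i) := by
    intro t
    rw [← Polynomial.coe_evalRingHom, RingHom.map_det]
    congr 1
    ext j i
    change Polynomial.eval t (M j i) = _
    simp [M]
    ring
  have hM0 : M.det ≠ 0 := by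
    intro h0
    have := hM 0
    rw [h0] at this
    have h1 : (Matrix.of fun j i => g ((A + (0:K) • B + (0:K) ^ 2 • C) (v j)) i) = 1 := by
      ext j i
      rw [Matrix.one_apply, Matrix.of_apply]
      simp only [zero_smul, add_zero, ne_eq, OfNat.ofNat_ne_zero, not_false_eq_true, zero_pow, hgA, Pi.single_apply]
      simp only [eq_comm]
    rw [h1, Matrix.det_one, Polynomial.eval_zero] at this
    exact zero_ne_one this
  have hfin : (S ∪ {t | M.det.IsRoot t}).Finite := hS.union (Polynomial.finite_setOfPred_isRoot hM0)
  obtain ⟨t, ht⟩ := hfin.infinite_compl.nonempty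
  simp only [Set.mem_compl_iff, Set.mem_union, not_or, Set.mem_ofPred_eq] at ht
  obtain ⟨ht1, ht2⟩ := ht
  have hdet : Matrix.det (Matrix.of fun j i => g ((A + t • B + t ^ 2 • C) (v j)) i) ≠ 0 := by
    rw [← hM]; exact ht2
  have hli : LinearIndependent K (fun j => g ((A + t • B + t ^ 2 • C) (v j))) :=
    Matrix.linearIndependent_rows_of_det_ne_zero hdet
  have hli2 : LinearIndependent K (fun j => ((A + t • B + t ^ 2 • C) (v j))) :=
    LinearIndependent.of_comp g hli
  have hle : m ≤ Module.finrank K (LinearMap.range (A + t • B + t ^ 2 • C)) := by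
    have h3 : LinearIndependent K (fun j => (⟨(A + t • B + t ^ 2 • C) (v j), LinearMap.mem_range_self _ _⟩ : LinearMap.range (A + t • B + t ^ 2 • C))) :=
      LinearIndependent.of_comp (LinearMap.range (A + t • B + t ^ 2 • C)).subtype hli2
    simpa using h3.fintype_card_le_finrank
  have e1 := LinearMap.finrank_range_add_finrank_ker A
  have e2 := LinearMap.finrank_range_add_finrank_ker (A + t • B + t ^ 2 • C)
  have := h t ht1
  omega

lemma finite_bad {K V X : Type*} [Field K] [AddCommGroup V] [Module K V] [FiniteDimensional K V]
    [Fintype X] (A B : X → V) (hB : LinearIndependent K B) (hc : Fintype.card X = Module.finrank K V) :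
    {t : K | ¬ LinearIndependent K (fun x => A x + t • B x)}.Finite := by
  classical
  let b : Module.Basis X K V := Module.Basis.mk hB (by
    rw [hB.span_eq_top_of_card_eq_finrank' hc])
  have hb : ∀ x, b x = B x := fun x => by simp [b]
  let f : V →ₗ[K] V := b.constr K A
  have hf : ∀ x, f (B x) = A x := fun x => by rw [← hb]; simp [f]
  have h1 : {s : K | Module.End.HasEigenvalue f s}.Finite := Module.End.finite_hasEigenvalue f
  refine (h1.preimage (f := fun t : K => -t) (neg_injective.injOn)).subset ?_
  intro t ht
  simp only [Set.mem_ofPred_eq, Set.mem_preimage] at *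
  by_contra hne
  apply ht
  have : LinearMap.ker (f + t • LinearMap.id) = ⊥ := by
    rw [Module.End.hasEigenvalue_iff, not_not, Module.End.eigenspace_def] at hne
    rw [← hne]
    congr 1
    ext v
    simp
  have := hB.map' _ this
  have e : (fun x => A x + t • B x) = (⇑(f + t • (LinearMap.id : V →ₗ[K] V)) ∘ B) := by
    funext x
    simp [hf]
  rw [e]
  exact this

lemma generic_basis {K V : Type*} [Field K] [AddCommGroup V] [Module K V] [FiniteDimensional K V]
    (hV : Module.finrank K V = 9) (p : Fin 3 → Fin 3 → V) (s : Fin 3 → V)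
    (h0 : LinearIndependent K (fun x : Fin 3 × Fin 3 => p x.1 x.2))
    (h1 : ∀ i, LinearIndependent K (fun x : Fin 3 × Fin 3 => if x.1 = i then s x.2 else p x.1 x.2)) :
    ∃ q : Module.Basis (Fin 3 × Fin 3) K V,
      (∀ i j, q (i, j) ∈ Submodule.span K (Set.range (p i))) ∧ ∀ j, s j = ∑ i, q (i, j) := by
  classical
  have hc : Fintype.card (Fin 3 × Fin 3) = Module.finrank K V := by simp [hV]
  let P : Module.Basis (Fin 3 × Fin 3) K V := Module.Basis.mk h0 (by
    rw [h0.span_eq_top_of_card_eq_finrank' hc])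
  have hP : ∀ x, P x = p x.1 x.2 := fun x => by simp [P]
  let q : Fin 3 × Fin 3 → V := fun x => ∑ k, P.repr (s x.2) (x.1, k) • p x.1 k
  have hs : ∀ j, s j = ∑ i, q (i, j) := by
    intro j
    conv_lhs => rw [← P.sum_repr (s j), Fintype.sum_prod_type]
    simp [q, hP]
  have hq : LinearIndependent K q := by
    rw [Fintype.linearIndependent_iff]
    intro c hcz
    have key : ∀ i k, ∑ j, c (i, j) * P.repr (s j) (i, k) = 0 := by
      have e : ∑ x : Fin 3 × Fin 3, (∑ j, c (x.1, j) * P.repr (s j) (x.1, x.2)) • p x.1 x.2 = 0 := by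
        rw [← hcz, Fintype.sum_prod_type, Fintype.sum_prod_type]
        refine Finset.sum_congr rfl fun i _ => ?_
        simp only [q, Finset.sum_smul, Finset.smul_sum, smul_smul]
        exact Finset.sum_comm
      have := Fintype.linearIndependent_iff.mp h0 _ e
      exact fun i k => this (i, k)
    rintro ⟨i, j⟩
    have e : ∑ x : Fin 3 × Fin 3, (if x.1 = i then c (i, x.2) else - ∑ j, c (i, j) * P.repr (s j) x) •
        (if x.1 = i then s x.2 else p x.1 x.2) = 0 := by
      have e1 : ∀ x : Fin 3 × Fin 3, (if x.1 = i then c (i, x.2) else - ∑ j, c (i, j) * P.repr (s j) x) •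
        (if x.1 = i then s x.2 else p x.1 x.2) = (if x.1 = i then c (i, x.2) • s x.2 else 0)
          - (∑ j, c (i, j) * P.repr (s j) x) • p x.1 x.2 := by
        rintro ⟨i', k⟩
        by_cases h : i' = i
        · subst h; simp [key]
        · simp [h]
      simp_rw [e1, Finset.sum_sub_distrib, Finset.sum_smul]
      rw [Finset.sum_comm (s := (Finset.univ : Finset (Fin 3 × Fin 3))), Fintype.sum_prod_type, sub_eq_zero]
      simp_rw [mul_smul, ← Finset.smul_sum, ← hP, P.sum_repr]
      rw [Finset.sum_comm]
      simp
    have := Fintype.linearIndependent_iff.mp (h1 i) _ e (i, j)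
    simpa using this
  refine ⟨Module.Basis.mk hq (by rw [hq.span_eq_top_of_card_eq_finrank' hc]), ?_, ?_⟩
  · intro i j
    simp only [Module.Basis.coe_mk, q]
    exact Submodule.sum_mem _ fun k _ => Submodule.smul_mem _ _ (Submodule.subset_span ⟨k, rfl⟩)
  · intro j; simp only [Module.Basis.coe_mk]; exact hs j
section
variable {K V : Type*} [Field K] [AddCommGroup V] [Module K V]

lemma iswap (x y : V) (w : ExteriorAlgebra K V) :
    ι K x * (ι K y * w) = -(ι K y * (ι K x * w)) := by
  rw [← mul_assoc, ← mul_assoc, ← neg_mul]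
  congr 1
  exact eq_neg_of_add_eq_zero_left (ι_add_mul_swap x y)

lemma cstep (f : Module.Dual K V) (x : V) (w : ExteriorAlgebra K V) :
    CliffordAlgebra.contractLeft f (ι K x * w) =
      f x • w - ι K x * CliffordAlgebra.contractLeft f w :=
  CliffordAlgebra.contractLeft_ι_mul f x w

lemma kstep (f g : Module.Dual K V) (x y : V) (w : ExteriorAlgebra K V)
    (fx : f x = 1) (fy : f y = 0) (gx : g x = 0) (gy : g y = 1)
    (h : ι K x * (ι K y * w) = 0) :
    w = ι K x * CliffordAlgebra.contractLeft f w + ι K y * CliffordAlgebra.contractLeft g w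
      - ι K x * (ι K y * CliffordAlgebra.contractLeft g (CliffordAlgebra.contractLeft f w)) := by
  have h1 := congrArg (fun z => CliffordAlgebra.contractLeft g (CliffordAlgebra.contractLeft f z)) h
  simp only [cstep, fx, fy, gx, gy, map_zero, map_add, one_smul, zero_smul, zero_sub, sub_neg_eq_add,
    mul_neg, mul_sub] at h1
  rw [← sub_eq_zero, ← h1]
  abel

lemma mem_Q_aux (H : Submodule K V) (w : ExteriorAlgebra K V) (hw : w ∈ ⋀[K]^6 V)
    (h : Fin 3 → V) (hH : ∀ i, h i ∈ H) (m : Fin 3 → ExteriorAlgebra K V)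
    (e : w = ι K (h 0) * (ι K (h 1) * m 0) + ι K (h 0) * (ι K (h 2) * m 1)
       + ι K (h 1) * (ι K (h 2) * m 2)) : w ∈ Q K 6 H := by
  classical
  have hι : ∀ x : V, ι K x ∈ ⋀[K]^1 V := fun x => by
    rw [ExteriorAlgebra.exteriorPower, pow_one]; exact LinearMap.mem_range_self _ x
  have key : ∀ (x y : V) (z : ExteriorAlgebra K V), x ∈ H → y ∈ H →
      (DirectSum.decompose (fun i : ℕ => ⋀[K]^i V) (ι K x * (ι K y * z)) 6 : ExteriorAlgebra K V) ∈ Q K 6 H := by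
    intro x y z hx hy
    rw [DirectSum.coe_decompose_mul_of_left_mem_of_le (fun i : ℕ => ⋀[K]^i V) (hι x) (by norm_num),
      DirectSum.coe_decompose_mul_of_left_mem_of_le (fun i : ℕ => ⋀[K]^i V) (hι y) (by norm_num)]
    exact Submodule.subset_span ⟨x, hx, y, hy, _, SetLike.coe_mem (DirectSum.decompose (fun i : ℕ => ⋀[K]^i V) z 4), (mul_assoc _ _ _).symm⟩
  have := DirectSum.decompose_of_mem_same (fun i : ℕ => ⋀[K]^i V) hw
  rw [← this, e]
  simp only [DirectSum.decompose_add, DirectSum.add_apply, Submodule.coe_add]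
  exact add_mem (add_mem (key _ _ _ (hH _) (hH _)) (key _ _ _ (hH _) (hH _))) (key _ _ _ (hH _) (hH _))

lemma mem_Q (H : Submodule K V) (w : ExteriorAlgebra K V) (hw : w ∈ ⋀[K]^6 V)
    (h : Fin 3 → V) (hH : ∀ i, h i ∈ H) (hli : LinearIndependent K h)
    (hz : ∀ i j, ι K (h i) * (ι K (h j) * w) = 0) : w ∈ Q K 6 H := by
  obtain ⟨f, hf⟩ : ∃ f : Fin 3 → Module.Dual K V, ∀ i j, f i (h j) = if i = j then 1 else 0 := by
    obtain ⟨g, hg⟩ := LinearMap.exists_leftInverse_of_injective (Fintype.linearCombination K h) (by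
      rw [LinearMap.ker_eq_bot']
      intro c hc
      rw [Fintype.linearCombination_apply] at hc
      exact funext (Fintype.linearIndependent_iff.mp hli c hc))
    refine ⟨fun i => LinearMap.proj i ∘ₗ g, fun i j => ?_⟩
    have := congrFun (LinearMap.congr_fun hg (Pi.single j 1)) i
    simpa [Fintype.linearCombination_apply_single, Pi.single_apply] using this
  have e01 := kstep (f 0) (f 1) (h 0) (h 1) w (by simp [hf]) (by simp [hf]) (by simp [hf]) (by simp [hf]) (hz _ _)
  have e02 := kstep (f 0) (f 2) (h 0) (h 2) w (by simp [hf]) (by simp [hf]) (by simp [hf]) (by simp [hf]) (hz _ _)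
  have e12 := kstep (f 1) (f 2) (h 1) (h 2) w (by simp [hf]) (by simp [hf]) (by simp [hf]) (by simp [hf]) (hz _ _)
  have c0 := congrArg (CliffordAlgebra.contractLeft (f 0)) e12
  have c1 := congrArg (CliffordAlgebra.contractLeft (f 1)) e02
  generalize CliffordAlgebra.contractLeft (f 2) (CliffordAlgebra.contractLeft (f 1) w) = u at *
  generalize CliffordAlgebra.contractLeft (f 2) (CliffordAlgebra.contractLeft (f 0) w) = u' at *
  generalize CliffordAlgebra.contractLeft (f 1) (CliffordAlgebra.contractLeft (f 0) w) = u'' at *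
  generalize CliffordAlgebra.contractLeft (f 2) w = z2 at *
  generalize hz1 : CliffordAlgebra.contractLeft (f 1) w = z1 at *
  generalize hz0 : CliffordAlgebra.contractLeft (f 0) w = z0 at *
  simp only [map_add, map_sub, cstep, hf] at c0 c1
  simp only [Fin.isValue, zero_ne_one, one_ne_zero, if_false, zero_smul, zero_sub, Fin.reduceEq, mul_neg, sub_neg_eq_add] at c0 c1
  generalize CliffordAlgebra.contractLeft (f 0) z1 = y1 at *
  generalize CliffordAlgebra.contractLeft (f 0) z2 = y2 at *
  generalize CliffordAlgebra.contractLeft (f 1) z0 = y3 at *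
  generalize CliffordAlgebra.contractLeft (f 1) z2 = y4 at *
  generalize CliffordAlgebra.contractLeft (f 0) u = y5 at *
  generalize CliffordAlgebra.contractLeft (f 1) u' = y6 at *
  rw [c0, c1] at e01
  simp only [mul_add, mul_sub, mul_neg] at e01
  rw [iswap (h 1) (h 0), iswap (h 1) (h 0)] at e01
  refine mem_Q_aux H w hw h hH ![-y1 + y3 - ι K (h 2) * y5 + ι K (h 2) * y6 - u'', -y2, -y4] ?_
  rw [e01]
  simp only [Matrix.cons_val, mul_add, mul_sub, mul_neg, mul_zero]
  abel
end

section
variable {K V : Type*} [Field K] [AddCommGroup V] [Module K V]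
lemma four_zero (p : Fin 3 → V) (x y a b : V) (m : ExteriorAlgebra K V)
    (hx : x ∈ Submodule.span K (Set.range p)) (hy : y ∈ Submodule.span K (Set.range p))
    (ha : a ∈ Submodule.span K (Set.range p)) (hb : b ∈ Submodule.span K (Set.range p)) :
    ι K x * (ι K y * (ι K a * (ι K b * m))) = 0 := by
  have h : ιMulti K 4 ![x, y, a, b] = 0 := by
    apply AlternatingMap.map_linearDependent
    intro hli
    have hmem : ∀ i, ![x, y, a, b] i ∈ Submodule.span K (Set.range p) := by
      intro i; fin_cases i <;> simpa
    have h2 : LinearIndependent K (fun i => (⟨![x, y, a, b] i, hmem i⟩ : Submodule.span K (Set.range p))) :=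
      LinearIndependent.of_comp (Submodule.span K (Set.range p)).subtype hli
    have : FiniteDimensional K (Submodule.span K (Set.range p)) :=
      FiniteDimensional.span_of_finite K (Set.finite_range p)
    have h3 := h2.fintype_card_le_finrank
    have h4 := finrank_range_le_card (R := K) p
    simp [Set.finrank] at h3 h4
    omega
  simp only [ιMulti_apply, List.ofFn_succ, List.ofFn_zero, List.prod_cons, List.prod_nil, mul_one] at h
  have := congrArg (· * m) h
  simpa [mul_assoc] using this

def PA (K : Type*) [Field K] : Fin 10 → Fin 3 → K :=
  ![![0,1,0], ![0,0,1], ![1,0,0], ![0,0,1], ![0,0,1], ![0,1,0], ![0,1,0], ![1,0,0], ![1,0,0], ![1,-1,0]]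
def PB (K : Type*) [Field K] : Fin 10 → Fin 3 → K :=
  ![![0,0,1], ![1,0,0], ![0,1,0], ![1,-1,0], ![-1,-1,0], ![-1,0,1], ![1,0,1], ![0,1,-1], ![0,-1,-1], ![0,1,-1]]
def cr (a b : Fin 3 → K) (i : Fin 3) : K := a (i+1) * b (i+2) - a (i+2) * b (i+1)

lemma cubics [CharZero K] (c : Fin 10 → K)
    (h : ∀ i j k, ∑ n, c n * (cr (PA K n) (PB K n) i * cr (PA K n) (PB K n) j * cr (PA K n) (PB K n) k) = 0) :
    ∀ n, c n = 0 := by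
  have h000 := h 0 0 0
  have h111 := h 1 1 1
  have h222 := h 2 2 2
  have h001 := h 0 0 1
  have h011 := h 0 1 1
  have h002 := h 0 0 2
  have h022 := h 0 2 2
  have h112 := h 1 1 2
  have h122 := h 1 2 2
  have h012 := h 0 1 2
  have e1 : (1 : Fin 3) + 1 = 2 := rfl
  have e2 : (1 : Fin 3) + 2 = 0 := rfl
  have e3 : (2 : Fin 3) + 1 = 0 := rfl
  have e4 : (2 : Fin 3) + 2 = 1 := rfl
  clear h
  simp [Fin.sum_univ_succ, cr, PA, PB, e1, e2, e3, e4] at *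
  clear e1 e2 e3 e4
  have c9 := h012
  have t : (2 : K) ≠ 0 := two_ne_zero
  have c3 : c 3 = 0 := mul_left_cancel₀ t (by linear_combination h001 + h011 - 2 * c9)
  have c4 : c 4 = 0 := by linear_combination h011 - c3 - c9
  have c5 : c 5 = 0 := mul_left_cancel₀ t (by linear_combination h002 + h022 - 2 * c9)
  have c6 : c 6 = 0 := by linear_combination h022 - c5 - c9
  have c7 : c 7 = 0 := mul_left_cancel₀ t (by linear_combination h112 + h122 - 2 * c9)
  have c8 : c 8 = 0 := by linear_combination h122 - c7 - c9
  have c0 : c 0 = 0 := by linear_combination h000 - c3 - c4 - c5 - c6 - c9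
  have c1 : c 1 = 0 := by linear_combination h111 - c3 + c4 - c7 - c8 - c9
  have c2 : c 2 = 0 := by linear_combination h222 - c5 + c6 - c7 + c8 - c9
  intro n
  fin_cases n <;> assumption

noncomputable def vec (q : Module.Basis (Fin 3 × Fin 3) K V) (a : Fin 3 → K) (i : Fin 3) : V := ∑ j, a j • q (i, j)

lemma vec_coord (q : Module.Basis (Fin 3 × Fin 3) K V) (a : Fin 3 → K) (i i' j : Fin 3) :
    q.coord (i', j) (vec q a i) = if i = i' then a j else 0 := by
  classical
  by_cases h : i = i'
  · subst h; simp [vec, Finsupp.single_apply]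
  · simp [vec, h]

noncomputable def FF (q : Module.Basis (Fin 3 × Fin 3) K V) (a b : Fin 3 → K) : ⋀[K]^6 V :=
  exteriorPower.ιMulti K 6 ![vec q a 0, vec q b 0, vec q a 1, vec q b 1, vec q a 2, vec q b 2]

lemma FF_coe (q : Module.Basis (Fin 3 × Fin 3) K V) (a b : Fin 3 → K) :
    (FF q a b : ExteriorAlgebra K V) = ι K (vec q a 0) * (ι K (vec q b 0) * (ι K (vec q a 1) *
      (ι K (vec q b 1) * (ι K (vec q a 2) * (ι K (vec q b 2) * 1))))) := by
  simp [FF, ιMulti_apply]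

lemma dra {n : Type} [Fintype n] [DecidableEq n] (N : n → n → K) :
    (Matrix.detRowAlternating (R := K) (n := n)) N = Matrix.det (Matrix.of N) := rfl

lemma det6 (a b c d a' b' c' d' a'' b'' c'' d'' : K) :
    Matrix.det !![a, b, 0, 0, 0, 0;
        c, d, 0, 0, 0, 0;
        0, 0, a', b', 0, 0;
        0, 0, c', d', 0, 0;
        0, 0, 0, 0, a'', b'';
        0, 0, 0, 0, c'', d''] = (a * d - b * c) * (a' * d' - b' * c') * (a'' * d'' - b'' * c'') := by
  rw [Matrix.det_succ_row_zero]
  simp [Fin.sum_univ_succ, Matrix.det_succ_row_zero, Fin.succAbove, Matrix.submatrix_apply]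
  ring

lemma FF_fun (q : Module.Basis (Fin 3 × Fin 3) K V) (i j k : Fin 3) :
    ∃ φ : ⋀[K]^6 V →ₗ[K] K, ∀ a b, φ (FF q a b) = cr a b i * cr a b j * cr a b k := by
  let co : V →ₗ[K] (Fin 6 → K) := LinearMap.pi
    ![q.coord (0, i+1), q.coord (0, i+2), q.coord (1, j+1), q.coord (1, j+2), q.coord (2, k+1), q.coord (2, k+2)]
  refine ⟨exteriorPower.alternatingMapLinearEquiv
    ((Matrix.detRowAlternating (R := K) (n := Fin 6)).compLinearMap co), fun a b => ?_⟩
  rw [FF, exteriorPower.alternatingMapLinearEquiv_apply_ιMulti, AlternatingMap.compLinearMap_apply]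
  rw [dra]
  have : Matrix.of (fun r => co (![vec q a 0, vec q b 0, vec q a 1, vec q b 1, vec q a 2, vec q b 2] r)) =
     !![a (i+1), a (i+2), 0, 0, 0, 0;
        b (i+1), b (i+2), 0, 0, 0, 0;
        0, 0, a (j+1), a (j+2), 0, 0;
        0, 0, b (j+1), b (j+2), 0, 0;
        0, 0, 0, 0, a (k+1), a (k+2);
        0, 0, 0, 0, b (k+1), b (k+2)] := by
    ext r s
    fin_cases r <;> fin_cases s <;> simp [co, vec_coord, -Module.Basis.coord_apply]
  rw [this]
  exact det6 _ _ _ _ _ _ _ _ _ _ _ _ 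

lemma FF_li [CharZero K] (q : Module.Basis (Fin 3 × Fin 3) K V) :
    LinearIndependent K (fun n => FF q (PA K n) (PB K n)) := by
  rw [Fintype.linearIndependent_iff]
  intro c hc
  apply cubics
  intro i j k
  obtain ⟨φ, hφ⟩ := FF_fun q i j k
  have := congrArg φ hc
  simpa [hφ] using this
end

section
variable {K V : Type*} [Field K] [AddCommGroup V] [Module K V]

lemma pair_swap (a b c d : V) (X : ExteriorAlgebra K V) :
    ι K a * (ι K b * (ι K c * (ι K d * X))) = ι K c * (ι K d * (ι K a * (ι K b * X))) := by
  rw [iswap b c, iswap b d, mul_neg, mul_neg, mul_neg, neg_neg, iswap a c, iswap a d,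
    mul_neg, neg_neg]

lemma sq0 (a : V) (X : ExteriorAlgebra K V) : ι K a * (ι K a * X) = 0 := by
  rw [← mul_assoc, ι_sq_zero, zero_mul]

lemma kill1 (a b : V) (X : ExteriorAlgebra K V) : ι K b * (ι K a * (ι K b * X)) = 0 := by
  rw [iswap a b, mul_neg, sq0, neg_zero]

lemma past2 (x a b : V) (X : ExteriorAlgebra K V) (h : ι K x * X = 0) :
    ι K x * (ι K a * (ι K b * X)) = 0 := by
  rw [iswap x a, iswap x b, h]; simp

lemma FF_kill (q : Module.Basis (Fin 3 × Fin 3) K V) (a b : Fin 3 → K)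
    (p : Fin 3 → Fin 3 → V) (s : Fin 3 → V)
    (hq : ∀ i j, q (i, j) ∈ Submodule.span K (Set.range (p i))) (hs : ∀ j, s j = ∑ i, q (i, j)) :
    (∀ i j k, ι K (p i j) * (ι K (p i k) * (FF q a b : ExteriorAlgebra K V)) = 0) ∧
    (∀ j k, ι K (s j) * (ι K (s k) * (FF q a b : ExteriorAlgebra K V)) = 0) := by
  have hv : ∀ a i, vec q a i ∈ Submodule.span K (Set.range (p i)) := fun a i =>
    Submodule.sum_mem _ fun j _ => Submodule.smul_mem _ _ (hq i j)
  have hp : ∀ i j, p i j ∈ Submodule.span K (Set.range (p i)) := fun i j =>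
    Submodule.subset_span ⟨j, rfl⟩
  have hsv : ∀ a, vec q a 0 + vec q a 1 + vec q a 2 = ∑ j, a j • s j := by
    intro a
    simp only [vec, hs, Finset.smul_sum]
    rw [Finset.sum_comm]
    simp only [Fin.sum_univ_three]
  have hsm : ∀ a, vec q a 0 + vec q a 1 + vec q a 2 ∈ Submodule.span K (Set.range s) := by
    intro a
    rw [hsv]
    exact Submodule.sum_mem _ fun j _ => Submodule.smul_mem _ _ (Submodule.subset_span ⟨j, rfl⟩)
  rw [FF_coe]
  constructor
  · intro i j k
    fin_cases i
    · exact four_zero (p 0) _ _ _ _ _ (hp 0 j) (hp 0 k) (hv a 0) (hv b 0)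
    · rw [pair_swap (vec q a 0)]
      exact four_zero (p 1) _ _ _ _ _ (hp 1 j) (hp 1 k) (hv a 1) (hv b 1)
    · rw [pair_swap (vec q a 1), pair_swap (vec q a 0)]
      exact four_zero (p 2) _ _ _ _ _ (hp 2 j) (hp 2 k) (hv a 2) (hv b 2)
  · intro j k
    generalize hm : ι K (vec q a 1) * (ι K (vec q b 1) * (ι K (vec q a 2) * (ι K (vec q b 2) * 1))) = m
    have a1 : ι K (vec q a 1) * m = 0 := by rw [← hm]; exact sq0 _ _
    have b1 : ι K (vec q b 1) * m = 0 := by rw [← hm]; exact kill1 _ _ _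
    have a2 : ι K (vec q a 2) * m = 0 := by rw [← hm]; exact past2 _ _ _ _ (sq0 _ _)
    have b2 : ι K (vec q b 2) * m = 0 := by rw [← hm]; exact past2 _ _ _ _ (kill1 _ _ _)
    have e : ι K (vec q a 0) * (ι K (vec q b 0) * m) =
        ι K (vec q a 0 + vec q a 1 + vec q a 2) * (ι K (vec q b 0 + vec q b 1 + vec q b 2) * m) := by
      simp only [map_add, add_mul, b1, b2, add_zero]
      rw [iswap (vec q a 1), iswap (vec q a 2), a1, a2]
      simp
    rw [e]
    exact four_zero s _ _ _ _ _ (Submodule.subset_span ⟨j, rfl⟩) (Submodule.subset_span ⟨k, rfl⟩)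
      (hsm a) (hsm b)

noncomputable def TT (x y : V) : ⋀[K]^6 V →ₗ[K] ExteriorAlgebra K V :=
  LinearMap.mulLeft K (ι K x) ∘ₗ LinearMap.mulLeft K (ι K y) ∘ₗ (⋀[K]^6 V).subtype

lemma TT_apply (x y : V) (w : ⋀[K]^6 V) : TT x y w = ι K x * (ι K y * (w : ExteriorAlgebra K V)) := rfl

lemma sum_li (b : Module.Basis (Fin 3 × Fin 3) K V) (i : Fin 3) :
    LinearIndependent K (fun x : Fin 3 × Fin 3 => if x.1 = i then ∑ i', b (i', x.2) else b x) := by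
  classical
  rw [Fintype.linearIndependent_iff]
  intro c hc
  have key : ∀ l k, c (i, k) + (if l = i then 0 else c (l, k)) = 0 := by
    intro l k
    have := congrArg (b.coord (l, k)) hc
    rw [Fintype.sum_prod_type, map_zero, map_sum] at this
    refine Eq.trans ?_ this
    fin_cases i <;> fin_cases l <;> fin_cases k <;>
      simp [Fin.sum_univ_three] <;> abel
  rintro ⟨l, k⟩
  have h1 := key i k
  have h2 := key l k
  simp at h1
  by_cases h : l = i
  · rw [h, h1]
  · simpa [h, h1] using h2

lemma kernel_bound [CharZero K] [FiniteDimensional K V]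
    (hV : Module.finrank K V = 9) (p : Fin 3 → Fin 3 → V) (s : Fin 3 → V)
    (h0 : LinearIndependent K (fun x : Fin 3 × Fin 3 => p x.1 x.2))
    (h1 : ∀ i, LinearIndependent K (fun x : Fin 3 × Fin 3 => if x.1 = i then s x.2 else p x.1 x.2))
    (N : Submodule K (⋀[K]^6 V))
    (hN : ∀ w : ⋀[K]^6 V, (∀ i j k, ι K (p i j) * (ι K (p i k) * (w : ExteriorAlgebra K V)) = 0) →
      (∀ j k, ι K (s j) * (ι K (s k) * (w : ExteriorAlgebra K V)) = 0) → w ∈ N) :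
    10 ≤ Module.finrank K N := by
  obtain ⟨q, hq, hs⟩ := generic_basis hV p s h0 h1
  have hmem : ∀ n, FF q (PA K n) (PB K n) ∈ N := fun n =>
    have h := FF_kill q (PA K n) (PB K n) p s hq hs
    hN _ h.1 h.2
  have hli : LinearIndependent K (fun n => (⟨_, hmem n⟩ : N)) :=
    LinearIndependent.of_comp N.subtype (FF_li q)
  simpa using hli.fintype_card_le_finrank

lemma main_bound [CharZero K] [FiniteDimensional K V]
    (hV : Module.finrank K V = 9) (p : Fin 3 → Fin 3 → V) (s : Fin 3 → V)
    (N : Submodule K (⋀[K]^6 V))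
    (hN : ∀ w : ⋀[K]^6 V, (∀ i j k, ι K (p i j) * (ι K (p i k) * (w : ExteriorAlgebra K V)) = 0) →
      (∀ j k, ι K (s j) * (ι K (s k) * (w : ExteriorAlgebra K V)) = 0) → w ∈ N) :
    10 ≤ Module.finrank K N := by
  classical
  have hc : Fintype.card (Fin 3 × Fin 3) = Module.finrank K V := by simp [hV]
  let b : Module.Basis (Fin 3 × Fin 3) K V :=
    (Module.finBasis K V).reindex (Fintype.equivOfCardEq (by simp [hV]))
  let r : Fin 3 → V := fun j => ∑ i, b (i, j)
  let Idx := (Fin 3 × Fin 3 × Fin 3) ⊕ (Fin 3 × Fin 3)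
  let A : ⋀[K]^6 V →ₗ[K] (Idx → ExteriorAlgebra K V) := LinearMap.pi
    (Sum.elim (fun x => TT (p x.1 x.2.1) (p x.1 x.2.2)) (fun x => TT (s x.1) (s x.2)))
  let B : ⋀[K]^6 V →ₗ[K] (Idx → ExteriorAlgebra K V) := LinearMap.pi
    (Sum.elim (fun x => TT (p x.1 x.2.1) (b (x.1, x.2.2)) + TT (b (x.1, x.2.1)) (p x.1 x.2.2))
      (fun x => TT (s x.1) (r x.2) + TT (r x.1) (s x.2)))
  let C : ⋀[K]^6 V →ₗ[K] (Idx → ExteriorAlgebra K V) := LinearMap.pi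
    (Sum.elim (fun x => TT (b (x.1, x.2.1)) (b (x.1, x.2.2))) (fun x => TT (r x.1) (r x.2)))
  have hfinal : 10 ≤ Module.finrank K (LinearMap.ker A) := by
    let S0 : Set K := {t | ¬ LinearIndependent K (fun x : Fin 3 × Fin 3 => p x.1 x.2 + t • b x)}
    let S1 : Fin 3 → Set K := fun i => {t | ¬ LinearIndependent K (fun x : Fin 3 × Fin 3 =>
      (if x.1 = i then s x.2 else p x.1 x.2) + t • (if x.1 = i then r x.2 else b x))}
    have hS : (S0 ∪ ⋃ i, S1 i).Finite :=
      (finite_bad _ _ b.linearIndependent hc).union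
        (Set.finite_iUnion fun i => finite_bad _ _ (sum_li b i) hc)
    refine semicont A B C 10 _ hS ?_
    intro t ht
    simp only [Set.mem_union, Set.mem_iUnion, not_or, not_exists] at ht
    obtain ⟨ht0, ht1⟩ := ht
    have ht0 := not_not.mp ht0
    have ht1 := fun i => not_not.mp (ht1 i)
    refine kernel_bound hV (fun i j => p i j + t • b (i, j)) (fun j => s j + t • r j) ht0 ?_ _ ?_
    · intro i
      have e : (fun x : Fin 3 × Fin 3 => if x.1 = i then s x.2 + t • r x.2 else p x.1 x.2 + t • b (x.1, x.2)) =
        (fun x : Fin 3 × Fin 3 =>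
          (if x.1 = i then s x.2 else p x.1 x.2) + t • (if x.1 = i then r x.2 else b x)) := by
        funext x; split_ifs <;> rfl
      rw [e]; exact ht1 i
    · intro w h1 h2
      rw [LinearMap.mem_ker]
      funext x
      have expand : ∀ x x' y y' : V, ι K (x + t • x') * (ι K (y + t • y') * (w : ExteriorAlgebra K V))
          = TT x y w + t • (TT x y' w + TT x' y w) + t ^ 2 • TT x' y' w := by
        intro x x' y y'
        simp only [TT_apply, map_add, map_smul, add_mul, mul_add, smul_mul_assoc, mul_smul_comm,
          smul_add, smul_smul, pow_two]
        abel
      rcases x with ⟨i, j, k⟩ | ⟨j, k⟩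
      · have := h1 i j k
        rw [expand] at this
        simpa [A, B, C] using this
      · have := h2 j k
        rw [expand] at this
        simpa [A, B, C] using this
  refine hfinal.trans (Submodule.finrank_mono ?_)
  intro w hw
  rw [LinearMap.mem_ker] at hw
  apply hN
  · intro i j k
    exact congrFun hw (Sum.inl (i, j, k))
  · intro j k
    exact congrFun hw (Sum.inr (j, k))
end

theorem stmt15 {K V : Type*} [Field K] [CharZero K] [IsAlgClosed K]
    [AddCommGroup V] [Module K V] [FiniteDimensional K V]
    (hV : Module.finrank K V = 9)
    (H₁ H₂ H₃ H₄ : Submodule K V) (hH₁ : Module.finrank K H₁ = 3)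
    (hH₂ : Module.finrank K H₂ = 3) (hH₃ : Module.finrank K H₃ = 3)
    (hH₄ : Module.finrank K H₄ = 3) :
    10 ≤ Module.finrank K ↥(Q K 6 H₁ ⊓ Q K 6 H₂ ⊓ Q K 6 H₃ ⊓ Q K 6 H₄) := by
  have ex : ∀ H : Submodule K V, Module.finrank K H = 3 →
      ∃ h : Fin 3 → V, (∀ i, h i ∈ H) ∧ LinearIndependent K h := by
    intro H hH
    let bb := Module.finBasisOfFinrankEq K H hH
    exact ⟨fun i => bb i, fun i => (bb i).2,
      bb.linearIndependent.map' H.subtype (Submodule.ker_subtype _)⟩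
  obtain ⟨h1, m1, l1⟩ := ex H₁ hH₁
  obtain ⟨h2, m2, l2⟩ := ex H₂ hH₂
  obtain ⟨h3, m3, l3⟩ := ex H₃ hH₃
  obtain ⟨h4, m4, l4⟩ := ex H₄ hH₄
  set I := Q K 6 H₁ ⊓ Q K 6 H₂ ⊓ Q K 6 H₃ ⊓ Q K 6 H₄ with hI
  have hb : 10 ≤ Module.finrank K (I.comap (⋀[K]^6 V).subtype) := by
    refine main_bound hV ![h1, h2, h3] h4 _ ?_
    intro w hw hw4
    rw [Submodule.mem_comap, hI]
    exact ⟨⟨⟨mem_Q H₁ _ w.2 h1 m1 l1 (hw 0), mem_Q H₂ _ w.2 h2 m2 l2 (hw 1)⟩,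
      mem_Q H₃ _ w.2 h3 m3 l3 (hw 2)⟩, mem_Q H₄ _ w.2 h4 m4 l4 hw4⟩
  have hle : I ≤ ⋀[K]^6 V := by
    have hι : ∀ x : V, ι K x ∈ ⋀[K]^1 V := fun x => by
      rw [ExteriorAlgebra.exteriorPower, pow_one]; exact LinearMap.mem_range_self _ x
    refine inf_le_right.trans (Submodule.span_le.mpr ?_)
    rintro z ⟨x, -, y, -, m, hm, rfl⟩
    exact SetLike.mul_mem_graded (A := fun i : ℕ => ⋀[K]^i V) (i := 2) (j := 4)
      (SetLike.mul_mem_graded (A := fun i : ℕ => ⋀[K]^i V) (i := 1) (j := 1) (hι x) (hι y)) hm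
  rwa [(Submodule.comapSubtypeEquivOfLe hle).finrank_eq] at hb
end

section
/- Let V be an 8-dimensional vector space over an algebraically closed field K of characteristic zero. There exist five 4-dimensional linear subspaces H_1, …, H_5 of V such that the intersection Q_4(H_1) ∩ Q_4(H_2) ∩ Q_4(H_3) ∩ Q_4(H_4) ∩ Q_4(H_5) inside ⋀^4 V is the zero subspace. -/
open ExteriorAlgebra

open CliffordAlgebra in
/-- contraction -/
noncomputable abbrev DD {K V : Type*} [Field K] [AddCommGroup V] [Module K V]
    (φ : Module.Dual K V) : ExteriorAlgebra K V →ₗ[K] ExteriorAlgebra K V :=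
  CliffordAlgebra.contractLeft (Q := (0 : QuadraticForm K V)) φ

section contr

variable {K V : Type*} [Field K] [AddCommGroup V] [Module K V]

theorem DD_mul (φ : Module.Dual K V) (a : V) (b : ExteriorAlgebra K V) :
    DD φ (ι K a * b) = φ a • b - ι K a * DD φ b :=
  CliffordAlgebra.contractLeft_ι_mul φ a b

theorem DD_zero_deg (φ : Module.Dual K V) (w : ExteriorAlgebra K V) (hw : w ∈ ⋀[K]^0 V) :
    DD φ w = 0 := by
  rw [exteriorPower, pow_zero, Submodule.mem_one] at hw
  obtain ⟨r, rfl⟩ := hw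
  exact CliffordAlgebra.contractLeft_algebraMap _ φ r

theorem pow_ind (n : ℕ) {P : ExteriorAlgebra K V → Prop}
    (hm : ∀ a : V, ∀ b ∈ ⋀[K]^n V, P (ι K a * b))
    (hadd : ∀ x y, P x → P y → P (x + y))
    (w : ExteriorAlgebra K V) (hw : w ∈ ⋀[K]^(n+1) V) : P w := by
  rw [exteriorPower, pow_succ'] at hw
  induction hw using Submodule.mul_induction_on' with
  | mem_mul_mem m hm' b hb =>
    obtain ⟨a, rfl⟩ := hm'
    exact hm a b hb
  | add x _ y _ hx hy => exact hadd x y hx hy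

theorem ι_mul_mem (n : ℕ) (a : V) (b : ExteriorAlgebra K V) (hb : b ∈ ⋀[K]^n V) :
    ι K a * b ∈ ⋀[K]^(n+1) V := by
  rw [exteriorPower, pow_succ']
  exact Submodule.mul_mem_mul ⟨a, rfl⟩ hb

theorem DD_mem (φ : Module.Dual K V) (n : ℕ) :
    ∀ w ∈ ⋀[K]^(n+1) V, DD φ w ∈ ⋀[K]^n V := by
  induction n with
  | zero =>
    apply pow_ind
    · intro a b hb
      rw [DD_mul, DD_zero_deg φ b hb, mul_zero, sub_zero]
      exact Submodule.smul_mem _ _ hb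
    · intro x y hx hy
      rw [map_add]; exact Submodule.add_mem _ hx hy
  | succ n ih =>
    apply pow_ind
    · intro a b hb
      rw [DD_mul]
      exact Submodule.sub_mem _ (Submodule.smul_mem _ _ hb) (ι_mul_mem n a _ (ih b hb))
    · intro x y hx hy
      rw [map_add]; exact Submodule.add_mem _ hx hy

theorem euler (b : Module.Basis (Fin 8) K V) (n : ℕ) :
    ∀ w ∈ ⋀[K]^n V, ∑ i, ι K (b i) * DD (b.coord i) w = (n : K) • w := by
  induction n with
  | zero =>
    intro w hw
    simp [DD_zero_deg _ w hw]
  | succ n ih =>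
    apply pow_ind
    · intro a w hw
      have h1 : ∀ i, ι K (b i) * DD (b.coord i) (ι K a * w)
          = ι K (b.repr a i • b i) * w + ι K a * (ι K (b i) * DD (b.coord i) w) := by
        intro i
        have h2 : ι K (b i) * ι K a = - (ι K a * ι K (b i)) :=
          eq_neg_of_add_eq_zero_left (ExteriorAlgebra.ι_add_mul_swap _ _)
        rw [DD_mul, mul_sub, ← mul_assoc (ι K (b i)) (ι K a), h2, map_smul]
        simp [mul_assoc]
      simp only [h1]
      rw [Finset.sum_add_distrib, ← Finset.sum_mul, ← Finset.mul_sum, ih w hw, ← map_sum,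
        b.sum_repr, mul_smul_comm]
      push_cast
      rw [add_smul, one_smul, add_comm]
    · intro x y hx hy
      simp only [map_add, mul_add, Finset.sum_add_distrib, hx, hy, smul_add]

theorem eq_zero_of_DD [CharZero K] (b : Module.Basis (Fin 8) K V) (n : ℕ)
    (w : ExteriorAlgebra K V) (hw : w ∈ ⋀[K]^(n+1) V)
    (h : ∀ i, DD (b.coord i) w = 0) : w = 0 := by
  have := euler b (n+1) w hw
  simp only [h, mul_zero, Finset.sum_const_zero] at this
  have h3 : ((n+1 : ℕ) : K) ≠ 0 := by exact_mod_cast Nat.succ_ne_zero n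
  exact (smul_eq_zero.mp this.symm).resolve_left h3

theorem eq_zero_of_DD4 [CharZero K] (b : Module.Basis (Fin 8) K V)
    (w : ExteriorAlgebra K V) (hw : w ∈ ⋀[K]^4 V)
    (h : ∀ i j k l, DD (b.coord i) (DD (b.coord j) (DD (b.coord k) (DD (b.coord l) w))) = 0) :
    w = 0 := by
  apply eq_zero_of_DD b 3 w hw
  intro l
  have h3 := DD_mem (b.coord l) 3 w hw
  apply eq_zero_of_DD b 2 _ h3
  intro k
  have h2 := DD_mem (b.coord k) 2 _ h3
  apply eq_zero_of_DD b 1 _ h2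
  intro j
  have h1 := DD_mem (b.coord j) 1 _ h2
  apply eq_zero_of_DD b 0 _ h1
  intro i
  exact h i j k l

theorem DD3_Q (H : Submodule K V) (w : ExteriorAlgebra K V) (hw : w ∈ Q K 4 H)
    (α β γ : Module.Dual K V) (hα : ∀ x ∈ H, α x = 0) (hβ : ∀ x ∈ H, β x = 0)
    (hγ : ∀ x ∈ H, γ x = 0) : DD α (DD β (DD γ w)) = 0 := by
  induction hw using Submodule.span_induction with
  | mem z hz =>
    obtain ⟨x, hx, y, hy, m, hm, rfl⟩ := hz
    have key : ∀ φ : Module.Dual K V, (∀ x ∈ H, φ x = 0) → ∀ u,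
        DD φ (ι K x * ι K y * u) = ι K x * ι K y * DD φ u := by
      intro φ hφ u
      rw [mul_assoc, DD_mul, DD_mul, hφ x hx, hφ y hy]
      simp [mul_assoc]
    rw [key γ hγ, key β hβ, key α hα,
      DD_zero_deg α _ (DD_mem β 0 _ (DD_mem γ 1 m hm)), mul_zero]
  | zero => simp
  | add x y _ _ hx hy => simp only [map_add, hx, hy, add_zero]
  | smul c x _ hx => simp only [map_smul, hx, smul_zero]

theorem Q_mem (H : Submodule K V) (w : ExteriorAlgebra K V) (hw : w ∈ Q K 4 H) :
    w ∈ ⋀[K]^4 V := by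
  refine Submodule.span_le.2 ?_ hw
  rintro z ⟨x, hx, y, hy, m, hm, rfl⟩
  rw [mul_assoc]
  exact ι_mul_mem 3 _ _ (ι_mul_mem 2 _ _ hm)

theorem DD_self (φ : Module.Dual K V) (w : ExteriorAlgebra K V) : DD φ (DD φ w) = 0 :=
  CliffordAlgebra.contractLeft_contractLeft φ w

theorem DD_comm (φ ψ : Module.Dual K V) (w : ExteriorAlgebra K V) :
    DD φ (DD ψ w) = - DD ψ (DD φ w) :=
  CliffordAlgebra.contractLeft_comm φ ψ w

end contr

/-- index sets of the four coordinate subspaces -/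
def SS : Fin 4 → Finset (Fin 8) := ![{1,3,4,6}, {0,2,3,5}, {0,1,5,7}, {2,5,6,7}]

set_option synthInstance.maxHeartbeats 400000 in
set_option synthInstance.maxSize 4000 in
set_option maxRecDepth 20000 in
theorem core {M : Type*} [AddCommGroup M] (f : Fin 8 → Fin 8 → Fin 8 → Fin 8 → M)
    (a1 : ∀ i j k l, f i j k l = - f j i k l)
    (a2 : ∀ i j k l, f i j k l = - f i k j l)
    (a3 : ∀ i j k l, f i j k l = - f i j l k)
    (d1 : ∀ i k l, f i i k l = 0)
    (d2 : ∀ i j l, f i j j l = 0)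
    (d3 : ∀ i j k, f i j k k = 0)
    (hS : ∀ m i j k l, j ∈ SS m → k ∈ SS m → l ∈ SS m → f i j k l = 0)
    (R1 : ∀ i, f i 0 2 4 + f i 0 3 4 + f i 1 2 4 + f i 1 3 4 = 0)
    (R2 : ∀ i, f i 0 2 6 + f i 0 2 7 + f i 0 3 6 + f i 0 3 7
      + f i 1 2 6 + f i 1 2 7 + f i 1 3 6 + f i 1 3 7 = 0)
    (R3 : ∀ i, f i 0 4 6 + f i 0 4 7 + f i 1 4 6 + f i 1 4 7 = 0)
    (R4 : ∀ i, f i 2 4 6 + f i 2 4 7 + f i 3 4 6 + f i 3 4 7 = 0) :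
    ∀ i j k l, f i j k l = 0 := by
  have z1 : ∀ i j k l, f i j k l = 0 → f j i k l = 0 := fun i j k l h => by rw [a1, h, neg_zero]
  have z2 : ∀ i j k l, f i j k l = 0 → f i k j l = 0 := fun i j k l h => by rw [a2, h, neg_zero]
  have z3 : ∀ i j k l, f i j k l = 0 → f i j l k = 0 := fun i j k l h => by rw [a3, h, neg_zero]
  have s0 : ∀ i j k l, f i j k l = 0 → f i j k l = 0 := fun i j k l h => h
  have s1 : ∀ i j k l, f i j k l = 0 → f j i k l = 0 := z1
  have s2 : ∀ i j k l, f i j k l = 0 → f j k i l = 0 := fun i j k l h => z2 _ _ _ _ (z1 _ _ _ _ h)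
  have s3 : ∀ i j k l, f i j k l = 0 → f j k l i = 0 := fun i j k l h => z3 _ _ _ _ (s2 _ _ _ _ h)
  have t0 : ∀ i j k l, f i j k l = 0 → f i j k l = 0 := s0
  have t1 : ∀ i j k l, f i j k l = 0 → f j i k l = 0 := z1
  have t2 : ∀ i j k l, f i j k l = 0 → f k i j l = 0 := fun i j k l h => z1 _ _ _ _ (z2 _ _ _ _ h)
  have t3 : ∀ i j k l, f i j k l = 0 → f l i j k = 0 := fun i j k l h => t2 _ _ _ _ (z3 _ _ _ _ h)
  have hz : ∀ i j k l, (i = j ∨ i = k ∨ i = l ∨ j = k ∨ j = l ∨ k = l ∨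
      ∃ m, (j ∈ SS m ∧ k ∈ SS m ∧ l ∈ SS m) ∨ (i ∈ SS m ∧ k ∈ SS m ∧ l ∈ SS m) ∨
        (i ∈ SS m ∧ j ∈ SS m ∧ l ∈ SS m) ∨ (i ∈ SS m ∧ j ∈ SS m ∧ k ∈ SS m)) →
      f i j k l = 0 := by
    rintro i j k l (rfl | rfl | rfl | rfl | rfl | rfl |
      ⟨m, ⟨h1, h2, h3⟩ | ⟨h1, h2, h3⟩ | ⟨h1, h2, h3⟩ | ⟨h1, h2, h3⟩⟩)
    · exact d1 _ _ _
    · exact z2 _ _ _ _ (d1 _ _ _)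
    · exact z3 _ _ _ _ (z2 _ _ _ _ (d1 _ _ _))
    · exact d2 _ _ _
    · exact z3 _ _ _ _ (d2 _ _ _)
    · exact d3 _ _ _
    · exact hS m _ _ _ _ h1 h2 h3
    · exact s1 _ _ _ _ (hS m _ _ _ _ h1 h2 h3)
    · exact s2 _ _ _ _ (hS m _ _ _ _ h1 h2 h3)
    · exact s3 _ _ _ _ (hS m _ _ _ _ h1 h2 h3)
  have h0124 : f 0 1 2 4 = 0 := by
    have h := R1 0
    rw [hz 0 0 2 4 (by decide), hz 0 0 3 4 (by decide), hz 0 1 3 4 (by decide)] at h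
    simp only [add_zero, zero_add] at h
    exact s0 _ _ _ _ h
  have h0126 : f 0 1 2 6 = 0 := by
    have h := R2 0
    rw [hz 0 0 2 6 (by decide), hz 0 0 2 7 (by decide), hz 0 0 3 6 (by decide), hz 0 0 3 7 (by decide), hz 0 1 2 7 (by decide), hz 0 1 3 6 (by decide), hz 0 1 3 7 (by decide)] at h
    simp only [add_zero, zero_add] at h
    exact s0 _ _ _ _ h
  have h0246 : f 0 2 4 6 = 0 := by
    have h := R1 6
    rw [hz 6 0 3 4 (by decide), hz 6 1 2 4 (by decide), hz 6 1 3 4 (by decide)] at h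
    simp only [add_zero, zero_add] at h
    exact s3 _ _ _ _ h
  have h0347 : f 0 3 4 7 = 0 := by
    have h := R3 3
    rw [hz 3 0 4 6 (by decide), hz 3 1 4 6 (by decide), hz 3 1 4 7 (by decide)] at h
    simp only [add_zero, zero_add] at h
    exact s1 _ _ _ _ h
  have h0247 : f 0 2 4 7 = 0 := by
    have h := R4 0
    rw [t0 _ _ _ _ h0246, hz 0 3 4 6 (by decide), t0 _ _ _ _ h0347] at h
    simp only [add_zero, zero_add] at h
    exact s0 _ _ _ _ h
  have h0367 : f 0 3 6 7 = 0 := by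
    have h := R2 6
    rw [hz 6 0 2 6 (by decide), hz 6 0 2 7 (by decide), hz 6 0 3 6 (by decide), hz 6 1 2 6 (by decide), hz 6 1 2 7 (by decide), hz 6 1 3 6 (by decide), hz 6 1 3 7 (by decide)] at h
    simp only [add_zero, zero_add] at h
    exact s2 _ _ _ _ h
  have h0456 : f 0 4 5 6 = 0 := by
    have h := R3 5
    rw [hz 5 0 4 7 (by decide), hz 5 1 4 6 (by decide), hz 5 1 4 7 (by decide)] at h
    simp only [add_zero, zero_add] at h
    exact s2 _ _ _ _ h
  have h0467 : f 0 4 6 7 = 0 := by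
    have h := R3 6
    rw [hz 6 0 4 6 (by decide), hz 6 1 4 6 (by decide), hz 6 1 4 7 (by decide)] at h
    simp only [add_zero, zero_add] at h
    exact s2 _ _ _ _ h
  have h1237 : f 1 2 3 7 = 0 := by
    have h := R2 2
    rw [hz 2 0 2 6 (by decide), hz 2 0 2 7 (by decide), hz 2 0 3 6 (by decide), hz 2 0 3 7 (by decide), hz 2 1 2 6 (by decide), hz 2 1 2 7 (by decide), hz 2 1 3 6 (by decide)] at h
    simp only [add_zero, zero_add] at h
    exact s1 _ _ _ _ h
  have h1245 : f 1 2 4 5 = 0 := by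
    have h := R1 5
    rw [hz 5 0 2 4 (by decide), hz 5 0 3 4 (by decide), hz 5 1 3 4 (by decide)] at h
    simp only [add_zero, zero_add] at h
    exact s3 _ _ _ _ h
  have h1247 : f 1 2 4 7 = 0 := by
    have h := R1 7
    rw [t3 _ _ _ _ h0247, t3 _ _ _ _ h0347, hz 7 1 3 4 (by decide)] at h
    simp only [add_zero, zero_add] at h
    exact s3 _ _ _ _ h
  have h2347 : f 2 3 4 7 = 0 := by
    have h := R4 2
    rw [hz 2 2 4 6 (by decide), hz 2 2 4 7 (by decide), hz 2 3 4 6 (by decide)] at h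
    simp only [add_zero, zero_add] at h
    exact s0 _ _ _ _ h
  have h3457 : f 3 4 5 7 = 0 := by
    have h := R4 5
    rw [hz 5 2 4 6 (by decide), hz 5 2 4 7 (by decide), hz 5 3 4 6 (by decide)] at h
    simp only [add_zero, zero_add] at h
    exact s2 _ _ _ _ h
  have sorted : ∀ i j k l : Fin 8, i < j → j < k → k < l → f i j k l = 0 := by
    intro i j k l hij hjk hkl
    have dec : ∀ i j k l : Fin 8, i < j → j < k → k < l →
      (∃ m, (j ∈ SS m ∧ k ∈ SS m ∧ l ∈ SS m) ∨ (i ∈ SS m ∧ k ∈ SS m ∧ l ∈ SS m) ∨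
        (i ∈ SS m ∧ j ∈ SS m ∧ l ∈ SS m) ∨ (i ∈ SS m ∧ j ∈ SS m ∧ k ∈ SS m)) ∨
      (i, j, k, l) ∈ ([(0, 1, 2, 4), (0, 1, 2, 6), (0, 2, 4, 6), (0, 2, 4, 7), (0, 3, 4, 7), (0, 3, 6, 7), (0, 4, 5, 6), (0, 4, 6, 7), (1, 2, 3, 7), (1, 2, 4, 5), (1, 2, 4, 7), (2, 3, 4, 7), (3, 4, 5, 7)] : List (Fin 8 × Fin 8 × Fin 8 × Fin 8)) := by
      decide
    rcases dec i j k l hij hjk hkl with h | h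
    · exact hz _ _ _ _ (by simp only [h, or_true])
    simp only [List.mem_cons, Prod.mk.injEq, List.not_mem_nil, or_false] at h
    rcases h with ⟨rfl, rfl, rfl, rfl⟩ | ⟨rfl, rfl, rfl, rfl⟩ | ⟨rfl, rfl, rfl, rfl⟩ | ⟨rfl, rfl, rfl, rfl⟩ | ⟨rfl, rfl, rfl, rfl⟩ | ⟨rfl, rfl, rfl, rfl⟩ | ⟨rfl, rfl, rfl, rfl⟩ | ⟨rfl, rfl, rfl, rfl⟩ | ⟨rfl, rfl, rfl, rfl⟩ | ⟨rfl, rfl, rfl, rfl⟩ | ⟨rfl, rfl, rfl, rfl⟩ | ⟨rfl, rfl, rfl, rfl⟩ | ⟨rfl, rfl, rfl, rfl⟩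
    · exact h0124
    · exact h0126
    · exact h0246
    · exact h0247
    · exact h0347
    · exact h0367
    · exact h0456
    · exact h0467
    · exact h1237
    · exact h1245
    · exact h1247
    · exact h2347
    · exact h3457
  have q1 : ∀ i j k l : Fin 8, j < k → k < l → f i j k l = 0 := by
    intro i j k l hjk hkl
    rcases lt_trichotomy i j with h | h | h
    · exact sorted _ _ _ _ h hjk hkl
    · exact hz _ _ _ _ (by simp [h])
    rcases lt_trichotomy i k with h' | h' | h'
    · exact t1 _ _ _ _ (sorted _ _ _ _ h h' hkl)
    · exact hz _ _ _ _ (by simp [h'])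
    rcases lt_trichotomy i l with h2 | h2 | h2
    · exact t2 _ _ _ _ (sorted _ _ _ _ hjk h' h2)
    · exact hz _ _ _ _ (by simp [h2])
    · exact t3 _ _ _ _ (sorted _ _ _ _ hjk hkl h2)
  have q2 : ∀ i j k l : Fin 8, k < l → f i j k l = 0 := by
    intro i j k l hkl
    rcases lt_trichotomy j k with h | h | h
    · exact q1 _ _ _ _ h hkl
    · exact hz _ _ _ _ (by simp [h])
    rcases lt_trichotomy j l with h' | h' | h'
    · exact z2 _ _ _ _ (q1 _ _ _ _ h h')
    · exact hz _ _ _ _ (by simp [h'])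
    · exact z2 _ _ _ _ (z3 _ _ _ _ (q1 _ _ _ _ hkl h'))
  intro i j k l
  rcases lt_trichotomy k l with h | h | h
  · exact q2 _ _ _ _ h
  · exact hz _ _ _ _ (by simp [h])
  · exact z3 _ _ _ _ (q2 _ _ _ _ h)

section final

variable {K V : Type*} [Field K] [AddCommGroup V] [Module K V]

/-- spanning vectors of the five subspaces -/
noncomputable def vecs (b : Module.Basis (Fin 8) K V) : Fin 5 → Fin 4 → V :=
  ![![b 0, b 2, b 5, b 7], ![b 1, b 4, b 6, b 7], ![b 2, b 3, b 4, b 6], ![b 0, b 1, b 3, b 4],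
    ![b 0 - b 1, b 2 - b 3, b 5, b 6 - b 7]]

theorem vecs_li (b : Module.Basis (Fin 8) K V) (m : Fin 5) : LinearIndependent K (vecs b m) := by
  rw [Fintype.linearIndependent_iff]
  intro g hg
  have hc : ∀ i, b.coord i (∑ j, g j • vecs b m j) = 0 := by intro i; rw [hg, map_zero]
  simp only [Fin.sum_univ_four] at hc
  have h0 := hc 0
  have h1 := hc 1
  have h2 := hc 2
  have h3 := hc 3
  have h4 := hc 4
  have h5 := hc 5
  have h6 := hc 6
  have h7 := hc 7
  clear hc hg
  intro i
  fin_cases m <;> simp [vecs, Finsupp.single_apply] at h0 h1 h2 h3 h4 h5 h6 h7 <;>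
    fin_cases i <;> simp_all

theorem vanish (b : Module.Basis (Fin 8) K V) (m : Fin 5) (φ : Module.Dual K V)
    (h : ∀ j, φ (vecs b m j) = 0) :
    ∀ x ∈ Submodule.span K (Set.range (vecs b m)), φ x = 0 := by
  intro x hx
  have : Submodule.span K (Set.range (vecs b m)) ≤ LinearMap.ker φ := by
    rw [Submodule.span_le]
    rintro _ ⟨j, rfl⟩
    exact h j
  exact this hx

theorem van1 (b : Module.Basis (Fin 8) K V) (m : Fin 4) (i : Fin 8) (hi : i ∈ SS m) :
    ∀ x ∈ Submodule.span K (Set.range (vecs b m.castSucc)), b.coord i x = 0 := by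
  apply vanish
  intro j
  fin_cases m <;> simp [SS] at hi <;> rcases hi with rfl | rfl | rfl | rfl <;>
    fin_cases j <;> simp [vecs, Finsupp.single_apply]

end final

theorem stmt16 {K V : Type*} [Field K] [CharZero K] [IsAlgClosed K]
    [AddCommGroup V] [Module K V] [FiniteDimensional K V]
    (hV : Module.finrank K V = 8) :
    ∃ H : Fin 5 → Submodule K V,
      (∀ i, Module.finrank K (H i) = 4) ∧ (⨅ i, Q K 4 (H i)) = ⊥ := by
  let b : Module.Basis (Fin 8) K V := Module.finBasisOfFinrankEq K V hV
  refine ⟨fun m => Submodule.span K (Set.range (vecs b m)), ?_, ?_⟩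
  · intro m
    rw [finrank_span_eq_card (vecs_li b m), Fintype.card_fin]
  rw [eq_bot_iff]
  intro w hw
  rw [Submodule.mem_iInf] at hw
  rw [Submodule.mem_bot]
  apply eq_zero_of_DD4 b w (Q_mem _ w (hw 0))
  have v01 := vanish b 4 (b.coord 0 + b.coord 1)
    (by intro j; fin_cases j <;> simp [vecs, Finsupp.single_apply])
  have v23 := vanish b 4 (b.coord 2 + b.coord 3)
    (by intro j; fin_cases j <;> simp [vecs, Finsupp.single_apply])
  have v4 := vanish b 4 (b.coord 4)
    (by intro j; fin_cases j <;> simp [vecs, Finsupp.single_apply])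
  have v67 := vanish b 4 (b.coord 6 + b.coord 7)
    (by intro j; fin_cases j <;> simp [vecs, Finsupp.single_apply])
  apply core (fun i j k l => DD (b.coord i) (DD (b.coord j) (DD (b.coord k) (DD (b.coord l) w))))
  · intro i j k l; exact DD_comm _ _ _
  · intro i j k l; rw [DD_comm (b.coord j), map_neg]
  · intro i j k l; rw [DD_comm (b.coord k), map_neg, map_neg]
  · intro i k l; exact DD_self _ _
  · intro i j l; rw [DD_self, map_zero]
  · intro i j k; rw [DD_self, map_zero, map_zero]
  · intro m i j k l hj hk hl
    rw [DD3_Q _ w (hw m.castSucc) _ _ _ (van1 b m j hj) (van1 b m k hk) (van1 b m l hl), map_zero]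
  · intro i
    have h := congrArg (DD (b.coord i)) (DD3_Q _ w (hw 4) _ _ _ v01 v23 v4)
    simp only [DD, map_add, LinearMap.add_apply, map_zero] at h ⊢
    rw [← h]; abel
  · intro i
    have h := congrArg (DD (b.coord i)) (DD3_Q _ w (hw 4) _ _ _ v01 v23 v67)
    simp only [DD, map_add, LinearMap.add_apply, map_zero] at h ⊢
    rw [← h]; abel
  · intro i
    have h := congrArg (DD (b.coord i)) (DD3_Q _ w (hw 4) _ _ _ v01 v4 v67)
    simp only [DD, map_add, LinearMap.add_apply, map_zero] at h ⊢
    rw [← h]; abel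
  · intro i
    have h := congrArg (DD (b.coord i)) (DD3_Q _ w (hw 4) _ _ _ v23 v4 v67)
    simp only [DD, map_add, LinearMap.add_apply, map_zero] at h ⊢
    rw [← h]; abel
end

section
/- Let V be a 12-dimensional vector space over an algebraically closed field K of characteristic zero. There exist four 4-dimensional linear subspaces H_1, H_2, H_3, H_4 of V such that the intersection Q_8(H_1) ∩ Q_8(H_2) ∩ Q_8(H_3) ∩ Q_8(H_4) inside ⋀^8 V has dimension exactly C(12,4) − 4·(4·8 + 1) = 363. -/
open ExteriorAlgebra

open Module Set Set.powersetCard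

section Aux
variable {K V : Type*} [Field K] [AddCommGroup V] [Module K V]

lemma aux_mul (b : Basis (Fin 12) K V) (s t : Finset (Fin 12)) (h : Disjoint s t) :
    ∃ e : ℤˣ, b.ExteriorAlgebra s * b.ExteriorAlgebra t = e • b.ExteriorAlgebra (s ∪ t) := by
  let s' : powersetCard (Fin 12) s.card := ofCard rfl
  let t' : powersetCard (Fin 12) t.card := ofCard rfl
  have h' : Disjoint s'.val t'.val := h
  refine ⟨(permOfDisjoint h').sign, ?_⟩
  have := ExteriorAlgebra.basis_mul_of_disjoint b s' t' h'
  rw [show s ∪ t = (disjUnion h').val from ?_]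
  · exact this
  · ext; simp [disjUnion, s', t']

lemma aux_mul0 (b : Basis (Fin 12) K V) (s t : Finset (Fin 12)) (h : ¬ Disjoint s t) :
    b.ExteriorAlgebra s * b.ExteriorAlgebra t = 0 := by
  let s' : powersetCard (Fin 12) s.card := ofCard rfl
  let t' : powersetCard (Fin 12) t.card := ofCard rfl
  exact ExteriorAlgebra.basis_mul_of_not_disjoint b s' t' h

lemma aux_one (b : Basis (Fin 12) K V) (i : Fin 12) :
    b.ExteriorAlgebra {i} = ι K (b i) := by
  rw [ExteriorAlgebra.basis_apply_ofCard b (n := 1) (by simp)]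
  simp only [ιMulti_family]
  rw [ιMulti_succ_apply, ιMulti_zero_apply, mul_one]
  simp [ofFinEmbEquiv_symm_apply, ofCard]

lemma aux_mem_s18 (b : Basis (Fin 12) K V) (n : ℕ) (s : Finset (Fin 12)) (h : s.card = n) :
    b.ExteriorAlgebra s ∈ ⋀[K]^n V := by
  have := ExteriorAlgebra.basis_eq_coe_basis b (ofCard h : powersetCard (Fin 12) n)
  change b.ExteriorAlgebra s = _ at this
  rw [this]
  exact Subtype.prop _

lemma aux_le (b : Basis (Fin 12) K V) (n : ℕ) :
    ⋀[K]^n V ≤ Submodule.span K (b.ExteriorAlgebra '' {s | s.card = n}) := by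
  intro m hm
  have h1 := (b.exteriorPower n).mem_span ⟨m, hm⟩
  have h2 := Submodule.mem_map_of_mem (f := (⋀[K]^n V).subtype) h1
  rw [Submodule.map_span] at h2
  refine Submodule.span_mono ?_ h2
  rintro _ ⟨_, ⟨s, rfl⟩, rfl⟩
  exact ⟨s.val, s.prop, ExteriorAlgebra.basis_eq_coe_basis b s⟩

lemma aux_Q (b : Basis (Fin 12) K V) (S : Finset (Fin 12)) :
    Q K 8 (Submodule.span K (b '' S)) =
      Submodule.span K (b.ExteriorAlgebra '' {T | T.card = 8 ∧ 2 ≤ (T ∩ S).card}) := by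
  apply le_antisymm
  · refine Submodule.span_le.2 ?_
    rintro _ ⟨x, hx, y, hy, m, hm, rfl⟩
    replace hm := aux_le b _ hm
    rw [SetLike.mem_coe]
    induction hx using Submodule.span_induction with
    | zero => simp
    | add x x' _ _ h h' => simp only [map_add, add_mul]; exact add_mem h h'
    | smul a x _ h =>
      simp only [map_smul, smul_mul_assoc]; exact Submodule.smul_mem _ _ h
    | mem x hx =>
    induction hy using Submodule.span_induction with
    | zero => simp
    | add x x' _ _ h h' => simp only [map_add, mul_add, add_mul]; exact add_mem h h'
    | smul a x _ h =>
      simp only [map_smul, smul_mul_assoc, mul_smul_comm]; exact Submodule.smul_mem _ _ h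
    | mem y hy =>
    induction hm using Submodule.span_induction with
    | zero => simp
    | add x x' _ _ h h' => simp only [mul_add]; exact add_mem h h'
    | smul a x _ h =>
      simp only [mul_smul_comm]; exact Submodule.smul_mem _ _ h
    | mem m hm =>
    obtain ⟨i, hi, rfl⟩ := hx
    obtain ⟨j, hj, rfl⟩ := hy
    obtain ⟨U, hU, rfl⟩ := hm
    rw [← aux_one, ← aux_one]
    by_cases hij : i = j
    · rw [aux_mul0 b {i} {j} (by simp [hij])]; simp
    obtain ⟨e, he⟩ := aux_mul b {i} {j} (by simpa using hij)
    rw [he, smul_mul_assoc]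
    by_cases hd : Disjoint ({i} ∪ {j} : Finset (Fin 12)) U
    · obtain ⟨e', he'⟩ := aux_mul b _ _ hd
      rw [he', smul_smul]
      have : b.ExteriorAlgebra ({i} ∪ {j} ∪ U) ∈
        Submodule.span K (b.ExteriorAlgebra '' {T | T.card = 8 ∧ 2 ≤ (T ∩ S).card}) := by
        refine Submodule.subset_span ⟨_, ⟨?_, ?_⟩, rfl⟩
        · rw [Finset.card_union_of_disjoint hd, Finset.card_union_of_disjoint (by simpa using hij)]
          have : U.card = 6 := hU
          simp [this]
        · rw [← Finset.card_pair hij]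
          apply Finset.card_le_card
          intro k hk
          simp only [Finset.mem_insert, Finset.mem_singleton] at hk
          rcases hk with rfl | rfl
          · simpa using hi
          · simpa using hj
      rcases Int.units_eq_one_or (e * e') with h | h <;> rw [h]
      · simpa using this
      · simpa [Units.smul_def] using this
    · rw [aux_mul0 b _ _ hd]; simp
  · refine Submodule.span_le.2 ?_
    rintro _ ⟨T, ⟨hT, hTS⟩, rfl⟩
    obtain ⟨i, hi, j, hj, hij⟩ := Finset.one_lt_card.1 hTS
    rw [Finset.mem_inter] at hi hj
    have hd : Disjoint ({i} ∪ {j} : Finset (Fin 12)) (T \ ({i} ∪ {j})) := Finset.disjoint_sdiff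
    have hsub : ({i} ∪ {j} : Finset (Fin 12)) ⊆ T := by
      intro k hk
      simp only [Finset.mem_union, Finset.mem_singleton] at hk
      rcases hk with rfl | rfl
      · exact hi.1
      · exact hj.1
    obtain ⟨e, he⟩ := aux_mul b {i} {j} (by simpa using hij)
    obtain ⟨e', he'⟩ := aux_mul b _ _ hd
    have key : ι K (b i) * ι K (b j) * b.ExteriorAlgebra (T \ ({i} ∪ {j})) ∈
        Q K 8 (Submodule.span K (b '' S)) := by
      refine Submodule.subset_span ⟨b i, Submodule.subset_span ⟨i, hi.2, rfl⟩, b j,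
        Submodule.subset_span ⟨j, hj.2, rfl⟩, _, aux_mem_s18 b _ _ ?_, rfl⟩
      rw [Finset.card_sdiff_of_subset hsub, Finset.card_union_of_disjoint (by simpa using hij), hT]
      simp
    rw [← aux_one, ← aux_one, he, smul_mul_assoc, he', smul_smul,
      Finset.union_sdiff_of_subset hsub] at key
    rcases Int.units_eq_one_or (e * e') with h | h <;> rw [h] at key
    · simpa using key
    · simpa [Units.smul_def] using key

/-- Four 4-subsets meeting pairwise in one point. -/
def auxS : Fin 4 → Finset (Fin 12) :=
  ![{0, 1, 2, 3}, {0, 4, 5, 6}, {1, 4, 7, 8}, {2, 5, 7, 9}]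

def auxC : Finset (Finset (Fin 12)) :=
  (Finset.powersetCard 8 Finset.univ).filter fun T => ∀ i, 2 ≤ (T ∩ auxS i).card

set_option maxRecDepth 100000 in
lemma auxC_card : auxC.card = 363 := by decide +kernel

lemma aux_inf_s18 (b : Basis (Fin 12) K V) :
    ⨅ i, Q K 8 (Submodule.span K (b '' auxS i)) =
      Submodule.span K (b.ExteriorAlgebra '' auxC) := by
  ext x
  simp only [Submodule.mem_iInf, aux_Q, Basis.mem_span_image, Set.subset_def]
  constructor
  · intro h T hT
    simp only [auxC, Finset.coe_filter, Finset.mem_powersetCard, Set.mem_ofPred_eq]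
    exact ⟨⟨Finset.subset_univ _, (h 0 T hT).1⟩, fun i => (h i T hT).2⟩
  · intro h i T hT
    have := h T hT
    simp only [auxC, Finset.coe_filter, Finset.mem_powersetCard, Set.mem_ofPred_eq] at this
    exact ⟨this.1.2, this.2 i⟩

lemma aux_finrank {I W : Type*} [AddCommGroup W] [Module K W] (B : Basis I K W) (C : Finset I) :
    finrank K (Submodule.span K (B '' C)) = C.card := by
  have h := finrank_span_eq_card (B.linearIndependent.comp (Subtype.val : C → I)
    Subtype.val_injective)
  rw [Set.range_comp] at h
  have h2 : Set.range (Subtype.val : C → I) = (C : Set I) := Subtype.range_coe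
  rw [h2] at h
  simpa using h

end Aux

/-- For a 12-dimensional space `V` there exist four 4-dimensional subspaces
`H₁, H₂, H₃, H₄` with `dim (Q₈(H₁) ∩ Q₈(H₂) ∩ Q₈(H₃) ∩ Q₈(H₄)) = C(12,4) - 4·(4·8 + 1) = 363`
inside `⋀^8 V`. -/
theorem stmt18 {K V : Type*} [Field K] [CharZero K] [IsAlgClosed K]
    [AddCommGroup V] [Module K V] [FiniteDimensional K V]
    (hV : Module.finrank K V = 12) :
    ∃ H : Fin 4 → Submodule K V,
      (∀ i, Module.finrank K (H i) = 4) ∧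
      Module.finrank K ↥(⨅ i, Q K 8 (H i)) = Nat.choose 12 4 - 4 * (4 * 8 + 1) ∧
      Module.finrank K ↥(⨅ i, Q K 8 (H i)) = 363 := by
  let b : Module.Basis (Fin 12) K V := Module.finBasisOfFinrankEq K V hV
  have h : Module.finrank K ↥(⨅ i, Q K 8 (Submodule.span K (b '' auxS i))) = 363 := by
    rw [aux_inf_s18, aux_finrank, auxC_card]
  refine ⟨fun i => Submodule.span K (b '' auxS i), fun i => ?_, ?_, h⟩
  · rw [aux_finrank]
    revert i
    decide
  · rw [h]
    decide
end
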